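/- arXiv:math/0605580 — 3 statements merged into one kernel-verified Lean document; each statement's English description precedes it below -/
import Mathlib

section
/- Let R be a noetherian local ring and M an R-module finite over a local homomorphism. If i > Gid_R(M) then the local cohomology module H^i_m(M) vanishes, where m is the maximal ideal of R. -/
open CategoryTheory IsLocalRing

universe u

noncomputable section

/-- Depth of a local ring: the supremum of lengths of regular sequences in the maximal ideal. -/
noncomputable def ringDepth (A : Type u) [CommRing A] [IsLocalRing A] : ℕ∞ :=
  sSup {c : ℕ∞ | ∃ rs : List A, c = rs.length ∧ (∀ x ∈ rs, x ∈ maximalIdeal A) ∧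
    RingTheory.Sequence.IsRegular A rs}

/-- Krull dimension of a module: the Krull dimension of its support. -/
noncomputable def moduleDim (R : Type u) [CommRing R] (M : Type u) [AddCommGroup M] [Module R M] :
    WithBot (WithTop ℕ) :=
  Order.krullDim (Module.support R M)

/-- A module is Gorenstein injective if it is a kernel in a complete exact complex of
injective modules which stays exact after applying `Hom(J, -)` for every injective `J`. -/
def IsGorensteinInjective (R : Type u) [CommRing R] (G : Type u) [AddCommGroup G] [Module R G] :
    Prop :=
  ∃ (I : ℤ → ModuleCat.{u} R) (d : ∀ n : ℤ, I n →ₗ[R] I (n - 1)),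
    (∀ n, Injective (I n)) ∧
    (∀ n : ℤ, Function.Exact (d n) (d (n - 1))) ∧
    (∀ J : ModuleCat.{u} R, Injective J → ∀ n : ℤ,
      Function.Exact (fun f : J →ₗ[R] I n => (d n).comp f)
        (fun f : J →ₗ[R] I (n - 1) => (d (n - 1)).comp f)) ∧
    Nonempty (G ≃ₗ[R] LinearMap.ker (d 0))

/-- `HasGidLE R M n` : there is an exact sequence `0 → M → G⁰ → ⋯ → Gⁿ → 0`
with all `Gⁱ` Gorenstein injective. -/
def HasGidLE (R : Type u) [CommRing R] (M : Type u) [AddCommGroup M] [Module R M] (n : ℕ) : Prop :=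
  ∃ (G : ℕ → ModuleCat.{u} R) (e : M →ₗ[R] G 0) (d : ∀ i : ℕ, G i →ₗ[R] G (i + 1)),
    (∀ i, IsGorensteinInjective R (G i)) ∧
    Function.Injective e ∧
    Function.Exact e (d 0) ∧
    (∀ i, Function.Exact (d i) (d (i + 1))) ∧
    (∀ i, n < i → Subsingleton (G i))

/-- Gorenstein injective dimension. -/
noncomputable def Gid (R : Type u) [CommRing R] (M : Type u) [AddCommGroup M] [Module R M] :
    ℕ∞ :=
  sInf {c : ℕ∞ | ∃ n : ℕ, c = n ∧ HasGidLE R M n}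

/-- `HasInjDimLE R M n` : there is an exact sequence `0 → M → I⁰ → ⋯ → Iⁿ → 0`
with all `Iⁱ` injective. -/
def HasInjDimLE (R : Type u) [CommRing R] (M : Type u) [AddCommGroup M] [Module R M] (n : ℕ) :
    Prop :=
  ∃ (I : ℕ → ModuleCat.{u} R) (e : M →ₗ[R] I 0) (d : ∀ i : ℕ, I i →ₗ[R] I (i + 1)),
    (∀ i, Injective (I i)) ∧
    Function.Injective e ∧
    Function.Exact e (d 0) ∧
    (∀ i, Function.Exact (d i) (d (i + 1))) ∧
    (∀ i, n < i → Subsingleton (I i))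

/-- Injective dimension. -/
noncomputable def injDim (R : Type u) [CommRing R] (M : Type u) [AddCommGroup M] [Module R M] :
    ℕ∞ :=
  sInf {c : ℕ∞ | ∃ n : ℕ, c = n ∧ HasInjDimLE R M n}

/-- `HasProjDimLE R M n` : there is an exact sequence `0 → Pₙ → ⋯ → P₀ → M → 0`
with all `Pᵢ` projective. -/
def HasProjDimLE (R : Type u) [CommRing R] (M : Type u) [AddCommGroup M] [Module R M] (n : ℕ) :
    Prop :=
  ∃ (P : ℕ → ModuleCat.{u} R) (e : P 0 →ₗ[R] M) (d : ∀ i : ℕ, P (i + 1) →ₗ[R] P i),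
    (∀ i, Projective (P i)) ∧
    Function.Surjective e ∧
    Function.Exact (d 0) e ∧
    (∀ i, Function.Exact (d (i + 1)) (d i)) ∧
    (∀ i, n < i → Subsingleton (P i))

/-- Width of a module over a local ring: `inf { i | Torᵢ(k, L) ≠ 0 }`. -/
noncomputable def moduleWidth (A : Type u) [CommRing A] [IsLocalRing A] (L : Type u)
    [AddCommGroup L] [Module A L] : ℕ∞ :=
  sInf {c : ℕ∞ | ∃ i : ℕ, c = i ∧
    ¬ Subsingleton (((Tor (ModuleCat.{u} A) i).obj
      (ModuleCat.of A (ResidueField A))).obj (ModuleCat.of A L))}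

/-- An injective module over a noetherian ring surjects onto its localization away from `x`. -/
lemma Module.Injective.exists_pow_smul_eq {R : Type u} [CommRing R] [IsNoetherianRing R]
    {I : Type u} [AddCommGroup I] [Module R I] (hI : Module.Injective R I) (x : R) :
    ∃ j : ℕ, ∀ (k : ℕ) (z : I), ∃ y : I, x ^ (j + k) • y = x ^ j • z := by
  obtain ⟨j, hj⟩ := (LinearMap.eventually_iSup_ker_pow_eq (LinearMap.mulLeft R x)).exists
  refine ⟨j, fun k z ↦ ?_⟩
  let f : R →ₗ[R] R := LinearMap.mulLeft R (x ^ (j + k))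
  let g : R →ₗ[R] I := LinearMap.toSpanSingleton R I (x ^ j • z)
  have hfg : LinearMap.ker f ≤ LinearMap.ker g := by
    intro r hr
    have hr' : r ∈ LinearMap.ker (LinearMap.mulLeft R x ^ (j + k)) := by
      simpa [f, LinearMap.pow_mulLeft] using hr
    have h := hj.le (Submodule.mem_iSup_of_mem (j + k) hr')
    rw [LinearMap.pow_mulLeft] at h
    have h' : x ^ j * r = 0 := h
    simp only [g, LinearMap.mem_ker, LinearMap.toSpanSingleton_apply, smul_smul]
    rw [mul_comm, h', zero_smul]
  obtain ⟨h, hh⟩ := hI.out ((LinearMap.ker f).liftQ f le_rfl)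
    (LinearMap.ker_eq_bot.mp (Submodule.ker_liftQ_eq_bot _ _ _ le_rfl))
    ((LinearMap.ker f).liftQ g hfg)
  refine ⟨h 1, ?_⟩
  have := hh (Submodule.Quotient.mk 1)
  simp only [Submodule.liftQ_apply, f, g, LinearMap.mulLeft_apply, mul_one,
    LinearMap.toSpanSingleton_apply, one_smul] at this
  rw [← this, ← map_smul, smul_eq_mul, mul_one]

/-- The submodule of elements killed by a power of `x`. -/
def powTorsion {R : Type u} [CommRing R] (x : R) (I : Type u) [AddCommGroup I] [Module R I] :
    Submodule R I where
  carrier := {z | ∃ k : ℕ, x ^ k • z = 0}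
  zero_mem' := ⟨0, smul_zero _⟩
  add_mem' := by
    rintro a b ⟨k, hk⟩ ⟨l, hl⟩
    refine ⟨k + l, ?_⟩
    rw [smul_add, pow_add, mul_smul, mul_smul, hl, smul_zero, add_zero, smul_comm, hk, smul_zero]
  smul_mem' := by
    rintro r a ⟨k, hk⟩
    exact ⟨k, by rw [smul_comm, hk, smul_zero]⟩

/-- Over a noetherian ring, the `x`-power torsion of an injective module is injective. -/
lemma injective_powTorsion {R : Type u} [CommRing R] [IsNoetherianRing R]
    {I : Type u} [AddCommGroup I] [Module R I] (hI : Module.Injective R I) (x : R) :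
    Module.Injective R (powTorsion x I) := by
  refine Module.Baer.injective fun b f ↦ ?_
  have hk : ∃ k : ℕ, ∀ r : b, x ^ k • f r = 0 := by
    have hb : (⊤ : Submodule R b).FG := (Submodule.fg_top b).mpr (isNoetherian_def.mp ‹_› b)
    obtain ⟨s, hs⟩ := hb
    choose e he using fun r : b ↦ (f r).2
    refine ⟨s.sup e, fun r ↦ ?_⟩
    have hr : r ∈ Submodule.span R (s : Set b) := hs ▸ Submodule.mem_top
    refine Submodule.span_induction (p := fun r _ ↦ x ^ s.sup e • f r = 0) ?_ (by simp) ?_ ?_ hr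
    · intro y hy
      obtain ⟨c, hc⟩ := Nat.exists_eq_add_of_le' (Finset.le_sup (f := e) hy)
      ext
      rw [hc, pow_add, mul_smul]
      simp [he y]
    · intro a b _ _ ha hb
      rw [map_add, smul_add, ha, hb, add_zero]
    · intro a b _ hb
      rw [map_smul, smul_comm, hb, smul_zero]
  obtain ⟨k, hk⟩ := hk
  obtain ⟨c, hc⟩ := Ideal.exists_pow_inf_eq_pow_smul (Ideal.span {x}) (M := R) b
  have hc' := hc (c + k) (by omega)
  have hker : ∀ r (hr : r ∈ b), r ∈ Ideal.span {x ^ (c + k)} → f ⟨r, hr⟩ = 0 := by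
    intro r hr hx
    have h1 : r ∈ Ideal.span {x} ^ (c + k) • (⊤ : Submodule R R) ⊓ b := by
      refine ⟨?_, hr⟩
      rw [Ideal.span_singleton_pow, smul_eq_mul, Ideal.mul_top]
      exact hx
    rw [hc', Nat.add_sub_cancel_left, Ideal.span_singleton_pow,
      Submodule.ideal_span_singleton_smul] at h1
    obtain ⟨y, ⟨-, hy⟩, rfl⟩ := (Submodule.mem_smul_pointwise_iff_exists _ _ _).mp h1
    have : (⟨x ^ k • y, hr⟩ : b) = x ^ k • ⟨y, hy⟩ := rfl
    rw [this, map_smul, hk]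
  let q : b →ₗ[R] R ⧸ Ideal.span {x ^ (c + k)} := (Submodule.mkQ _).comp b.subtype
  have hq : LinearMap.ker q ≤ LinearMap.ker f := by
    rintro ⟨r, hr⟩ h
    exact hker r hr ((Submodule.Quotient.mk_eq_zero _).mp h)
  obtain ⟨h, hh⟩ := hI.out ((LinearMap.ker q).liftQ q le_rfl)
    (LinearMap.ker_eq_bot.mp (Submodule.ker_liftQ_eq_bot _ _ _ le_rfl))
    ((LinearMap.ker q).liftQ ((powTorsion x I).subtype.comp f)
      (hq.trans (LinearMap.ker_le_ker_comp _ _)))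
  have ht : ∀ r, h r ∈ powTorsion x I := by
    intro r
    refine ⟨c + k, ?_⟩
    obtain ⟨r, rfl⟩ := Submodule.Quotient.mk_surjective _ r
    rw [← map_smul, ← Submodule.Quotient.mk_smul, (Submodule.Quotient.mk_eq_zero _).mpr, map_zero]
    exact Ideal.mul_mem_right _ _ (Ideal.mem_span_singleton_self _)
  refine ⟨(h.codRestrict _ ht).comp (Submodule.mkQ _), fun r hr ↦ Subtype.ext ?_⟩
  exact hh (Submodule.Quotient.mk ⟨r, hr⟩)

/-- Passing to `x`-power torsion preserves exactness at the third spot of an exact sequence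
whose first module is injective. -/
lemma exists_mem_powTorsion_of_exact {R : Type u} [CommRing R] [IsNoetherianRing R]
    {A B C : Type u} [AddCommGroup A] [Module R A] [AddCommGroup B] [Module R B]
    [AddCommGroup C] [Module R C] (hA : Module.Injective R A) (f : A →ₗ[R] B) (g : B →ₗ[R] C)
    (hfg : Function.Exact f g) (x : R) (b : B) (hb : g b ∈ powTorsion x C) :
    ∃ b' ∈ powTorsion x B, g b' = g b := by
  obtain ⟨k, hk⟩ := hb
  obtain ⟨u, hu⟩ := (hfg (x ^ k • b)).mp (by rw [map_smul, hk])
  obtain ⟨j, hj⟩ := hA.exists_pow_smul_eq x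
  obtain ⟨y, hy⟩ := hj k u
  refine ⟨b - f y, ⟨j + k, ?_⟩, by simp [hfg.apply_apply_eq_zero]⟩
  rw [smul_sub, ← map_smul, hy, map_smul, hu, smul_smul, ← pow_add, sub_self]

/-- Torsion cycles in an exact complex of injectives are boundaries of torsion elements, where
torsion refers to powers of each element of a list. -/
lemma exists_torsion_preimage {R : Type u} [CommRing R] [IsNoetherianRing R] (s : List R) :
    ∀ (I : ℤ → Type u) [∀ n, AddCommGroup (I n)] [∀ n, Module R (I n)]
      (d : ∀ n, I n →ₗ[R] I (n - 1)) (_ : ∀ n, Module.Injective R (I n))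
      (_ : ∀ n, Function.Exact (d n) (d (n - 1)))
      (n : ℤ) (z : I (n - 1)) (_ : d (n - 1) z = 0) (_ : ∀ x ∈ s, ∃ k : ℕ, x ^ k • z = 0),
      ∃ w : I n, d n w = z ∧ ∀ x ∈ s, ∃ k : ℕ, x ^ k • w = 0 := by
  induction s with
  | nil =>
    intro I _ _ d _ hd n z hz _
    obtain ⟨w, hw⟩ := (hd n z).mp hz
    exact ⟨w, hw, by simp⟩
  | cons x s ih =>
    intro I _ _ d hI hd n z hz hs
    have hmap : ∀ n, ∀ z ∈ powTorsion x (I n), d n z ∈ powTorsion x (I (n - 1)) := by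
      rintro n z ⟨k, hk⟩
      exact ⟨k, by rw [← map_smul, hk, map_zero]⟩
    have hex (n : ℤ) : Function.Exact ((d n).restrict (hmap n))
        ((d (n - 1)).restrict (hmap (n - 1))) := by
      rintro ⟨z, hzt⟩
      constructor
      · intro hz
        obtain ⟨w, rfl⟩ := (hd n z).mp (congrArg Subtype.val hz)
        have key : ∀ m, m - 1 = n → ∃ w' ∈ powTorsion x (I n), d n w' = d n w := by
          rintro _ rfl
          exact exists_mem_powTorsion_of_exact (hI _) _ _ (hd _) x w hzt
        obtain ⟨w', hw', h⟩ := key (n + 1) (by ring)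
        exact ⟨⟨w', hw'⟩, Subtype.ext h⟩
      · rintro ⟨⟨w, hw⟩, h⟩
        obtain rfl : d n w = z := congrArg Subtype.val h
        exact Subtype.ext ((hd n).apply_apply_eq_zero w)
    obtain ⟨w, hw, hws⟩ := ih (fun n ↦ powTorsion x (I n)) _
      (fun n ↦ injective_powTorsion (hI n) x) hex n ⟨z, hs x (by simp)⟩ (Subtype.ext hz)
      (fun y hy ↦ (hs y (by simp [hy])).imp fun k hk ↦ Subtype.ext hk)
    refine ⟨w, congrArg Subtype.val hw, fun y hy ↦ ?_⟩
    rcases List.mem_cons.mp hy with rfl | hy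
    · exact w.2
    · exact (hws y hy).imp fun k hk ↦ congrArg Subtype.val hk

/-- Ideal-power torsion cycles in an exact complex of injectives are boundaries of
ideal-power torsion elements. -/
lemma exists_ideal_torsion_preimage {R : Type u} [CommRing R] [IsNoetherianRing R] (J : Ideal R)
    (I : ℤ → Type u) [∀ n, AddCommGroup (I n)] [∀ n, Module R (I n)]
    (d : ∀ n, I n →ₗ[R] I (n - 1)) (hI : ∀ n, Module.Injective R (I n))
    (hd : ∀ n, Function.Exact (d n) (d (n - 1)))
    (n : ℤ) (z : I (n - 1)) (hz : d (n - 1) z = 0) (t : ℕ) (ht : ∀ r ∈ J ^ t, r • z = 0) :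
    ∃ w : I n, d n w = z ∧ ∃ s : ℕ, ∀ r ∈ J ^ s, r • w = 0 := by
  obtain ⟨S, hS⟩ := isNoetherian_def.mp ‹IsNoetherianRing R› J
  obtain ⟨w, hw, hws⟩ := exists_torsion_preimage S.toList I d hI hd n z hz fun x hx ↦
    ⟨t, ht _ (Ideal.pow_mem_pow (hS ▸ Submodule.subset_span (by simpa using hx)) t)⟩
  refine ⟨w, hw, ?_⟩
  have hJ : J ≤ Ideal.radical (LinearMap.ker (LinearMap.toSpanSingleton R (I n) w)) := by
    rw [← hS, Ideal.submodule_span_eq, Ideal.span_le]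
    intro x hx
    obtain ⟨k, hk⟩ := hws x (by simpa using hx)
    exact ⟨k, by simpa using hk⟩
  obtain ⟨s, hs⟩ := Ideal.exists_pow_le_of_le_radical_of_fg hJ (isNoetherian_def.mp ‹_› J)
  exact ⟨s, fun r hr ↦ by simpa using hs hr⟩

/-- A homology class of a chain complex in the opposite category of modules is represented by a
cocycle, and it is killed by a chain map which turns that cocycle into a coboundary. -/
lemma exists_cocycle_of_homology_op {R : Type u} [CommRing R]
    (K : ChainComplex (ModuleCat.{u} R)ᵒᵖ ℕ) (m n p : ℕ) (y : (K.homology n).unop) :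
    ∃ z : (K.X n).unop, (K.d m n).unop.hom z = 0 ∧
      ∀ (K' : ChainComplex (ModuleCat.{u} R)ᵒᵖ ℕ) (Φ : K' ⟶ K) (ψ : (K'.X p).unop),
        (K'.d n p).unop.hom ψ = (Φ.f n).unop.hom z →
          (HomologicalComplex.homologyMap Φ n).unop.hom y = 0 := by
  have hι : Function.Surjective (K.homologyι n).unop.hom :=
    (ModuleCat.epi_iff_surjective _).mp inferInstance
  obtain ⟨c, rfl⟩ := hι y
  refine ⟨(K.pOpcycles n).unop.hom c,
    congrArg (fun f ↦ f.unop.hom c) (K.d_pOpcycles m n), fun K' Φ ψ hψ ↦ ?_⟩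
  have hp : Function.Injective (K'.pOpcycles n).unop.hom :=
    (ModuleCat.mono_iff_injective _).mp inferInstance
  have h : (HomologicalComplex.opcyclesMap Φ n).unop.hom c =
      (K'.fromOpcycles n p).unop.hom ψ := by
    apply hp
    have e₁ := congrArg (fun f ↦ f.unop.hom c) (HomologicalComplex.p_opcyclesMap Φ n)
    have e₂ := congrArg (fun f ↦ f.unop.hom ψ) (K'.p_fromOpcycles n p)
    exact e₁.trans (hψ.symm.trans e₂.symm)
  have e₁ := congrArg (fun f ↦ f.unop.hom c) (HomologicalComplex.homologyι_naturality Φ n)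
  have e₂ := congrArg (fun f ↦ f.unop.hom ψ) (K'.homologyι_comp_fromOpcycles n p)
  exact e₁.trans ((congrArg (K'.homologyι n).unop.hom h).trans e₂)

/-- Each class in derived-functor `Ext` has a counterpart in Yoneda `Ext` such that the pullbacks
of the former vanish as soon as those of the latter do. -/
lemma exists_abelianExt {R : Type u} [CommRing R] (N M : ModuleCat.{u} R) (p : ℕ)
    (x : ((_root_.Ext R (ModuleCat.{u} R) (p + 1)).obj (.op N)).obj M) :
    ∃ e : Abelian.Ext N M (p + 1), ∀ (N' : ModuleCat.{u} R) (g : N' ⟶ N),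
      (Abelian.Ext.mk₀ g).comp e (zero_add _) = 0 →
        (((_root_.Ext R (ModuleCat.{u} R) (p + 1)).map g.op).app M).hom x = 0 := by
  let F := ((linearYoneda R (ModuleCat.{u} R)).obj M).rightOp
  let P := projectiveResolution N
  obtain ⟨y, rfl⟩ : ∃ y, (P.isoLeftDerivedObj F (p + 1)).hom.unop.hom y = x :=
    ⟨(P.isoLeftDerivedObj F (p + 1)).inv.unop.hom x,
      congrArg (fun f ↦ f.unop.hom x) (P.isoLeftDerivedObj F (p + 1)).hom_inv_id⟩
  obtain ⟨φ, hφ, h⟩ := exists_cocycle_of_homology_op _ (p + 2) _ p y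
  replace hφ : P.complex.d (p + 2) (p + 1) ≫ (show P.complex.X (p + 1) ⟶ M from φ) = 0 := hφ
  refine ⟨P.extMk φ (p + 2) rfl hφ, fun N' g hg ↦ ?_⟩
  let P' := projectiveResolution N'
  let l : P'.Hom P g := ⟨ProjectiveResolution.lift g P' P,
    HomologicalComplex.congr_hom (ProjectiveResolution.lift_commutes g P' P) 0⟩
  rw [ProjectiveResolution.mk₀_comp_extMk φ _ _ hφ l,
    ProjectiveResolution.extMk_eq_zero_iff _ _ _ _ _ p rfl] at hg
  obtain ⟨ψ, hψ⟩ := hg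
  have h0 := h _ ((F.mapHomologicalComplex (ComplexShape.down ℕ)).map l.hom) ψ hψ
  have hcomm := congrArg Quiver.Hom.unop
    (ProjectiveResolution.isoLeftDerivedObj_hom_naturality g P' P l.hom
      (by simpa using l.hom_f_zero_comp_π_f_zero) F (p + 1))
  exact (congrArg (fun f ↦ f.hom y) hcomm).trans
    ((congrArg (P'.isoLeftDerivedObj F (p + 1)).hom.unop.hom h0).trans (map_zero _))

/-- The transition map `R ⧸ J ^ s → R ⧸ J ^ t` for `t ≤ s`. -/
def powQuotientMap {R : Type u} [CommRing R] (J : Ideal R) {t s : ℕ} (h : t ≤ s) :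
    ModuleCat.of R (R ⧸ J ^ s) ⟶ ModuleCat.of R (R ⧸ J ^ t) :=
  ModuleCat.ofHom (Submodule.mapQ _ _ LinearMap.id (Ideal.pow_le_pow_right h))

lemma powQuotientMap_comp {R : Type u} [CommRing R] (J : Ideal R) {t s r : ℕ} (h : t ≤ s)
    (h' : s ≤ r) :
    powQuotientMap J h' ≫ powQuotientMap J h = powQuotientMap J (h.trans h') := by
  ext
  rfl

/-- Every class in `Ext ^ i (R ⧸ J ^ t, M)` dies in `Ext ^ i (R ⧸ J ^ s, M)` for some `s ≥ t`. -/
def ExtColimVanishes {R : Type u} [CommRing R] (J : Ideal R) (M : ModuleCat.{u} R) (i : ℕ) :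
    Prop :=
  ∀ (t : ℕ) (e : Abelian.Ext (ModuleCat.of R (R ⧸ J ^ t)) M i),
    ∃ (s : ℕ) (h : t ≤ s), (Abelian.Ext.mk₀ (powQuotientMap J h)).comp e (zero_add i) = 0

lemma ExtColimVanishes.subsingleton_localCohomology {R : Type u} [CommRing R] {J : Ideal R}
    {M : ModuleCat.{u} R} {p : ℕ} (hM : ExtColimVanishes J M (p + 1)) :
    Subsingleton ((localCohomology J (p + 1)).obj M) := by
  let D := localCohomology.diagram (localCohomology.idealPowersDiagram J) (p + 1)
  have := localCohomology.hasColimitDiagram.{u, 0} (localCohomology.idealPowersDiagram J) (p + 1)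
  let c := Limits.isColimitOfPreserves ((evaluation _ _).obj M) (Limits.colimit.isColimit D)
  refine ModuleCat.isZero_iff_subsingleton.mp
    ((Limits.IsZero.iff_id_eq_zero _).mpr (c.hom_ext fun j ↦ ?_))
  ext y
  obtain ⟨e, he⟩ := exists_abelianExt _ M p y
  obtain ⟨s, hs, h⟩ := hM j.unop.unop e
  let w : j ⟶ .op (.op s) := (homOfLE hs).op.op
  have hw := congrArg (fun f ↦ (f.app M).hom y) (Limits.colimit.w D w)
  exact hw.symm.trans ((congrArg ((Limits.colimit.ι D (.op (.op s))).app M).hom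
    (he _ _ h)).trans (map_zero _))

lemma ExtColimVanishes.of_iso {R : Type u} [CommRing R] {J : Ideal R} {M N : ModuleCat.{u} R}
    {i : ℕ} (hM : ExtColimVanishes J M i) (φ : M ≅ N) : ExtColimVanishes J N i := by
  intro t e
  obtain ⟨s, hs, h⟩ := hM t (e.comp (Abelian.Ext.mk₀ φ.inv) (add_zero i))
  refine ⟨s, hs, ?_⟩
  have := congrArg (fun x ↦ x.comp (Abelian.Ext.mk₀ φ.hom) (add_zero i)) h
  simpa using this

lemma ExtColimVanishes.of_injective {R : Type u} [CommRing R] (J : Ideal R) (M : ModuleCat.{u} R)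
    [Injective M] (p : ℕ) : ExtColimVanishes J M (p + 1) :=
  fun t e ↦ ⟨t, le_rfl, by rw [e.eq_zero_of_injective, Abelian.Ext.comp_zero]⟩

lemma ExtColimVanishes.of_shortExact {R : Type u} [CommRing R] {J : Ideal R}
    {S : ShortComplex (ModuleCat.{u} R)} (hS : S.ShortExact) {i : ℕ}
    (h₃ : ExtColimVanishes J S.X₃ i) (h₂ : ExtColimVanishes J S.X₂ (i + 1)) :
    ExtColimVanishes J S.X₁ (i + 1) := by
  intro t e
  obtain ⟨s, hs, h⟩ := h₂ t (e.comp (Abelian.Ext.mk₀ S.f) (add_zero _))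
  obtain ⟨e₃, he₃⟩ := Abelian.Ext.covariant_sequence_exact₁ _ hS
    ((Abelian.Ext.mk₀ (powQuotientMap J hs)).comp e (zero_add _)) (by simpa using h) rfl
  obtain ⟨r, hr, h'⟩ := h₃ s e₃
  refine ⟨r, hs.trans hr, ?_⟩
  rw [← powQuotientMap_comp J hs hr, ← Abelian.Ext.mk₀_comp_mk₀_assoc, ← he₃,
    ← Abelian.Ext.comp_assoc _ _ _ (zero_add _) _ (by omega), h', Abelian.Ext.zero_comp]

/-- The cycles of an unbounded exact complex of injectives have no local cohomology in positive
degrees. -/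
lemma extColimVanishes_ker {R : Type u} [CommRing R] [IsNoetherianRing R] (J : Ideal R)
    (I : ℤ → ModuleCat.{u} R) (d : ∀ n : ℤ, I n →ₗ[R] I (n - 1)) (hI : ∀ n, Injective (I n))
    (hd : ∀ n : ℤ, Function.Exact (d n) (d (n - 1))) (p : ℕ) :
    ∀ n : ℤ, ExtColimVanishes J (ModuleCat.of R (LinearMap.ker (d n))) (p + 1) := by
  let π (n : ℤ) : I n →ₗ[R] LinearMap.ker (d (n - 1)) :=
    (d n).codRestrict _ fun x ↦ (hd n).apply_apply_eq_zero x
  let S (n : ℤ) : ShortComplex (ModuleCat.{u} R) :=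
    .mk (ModuleCat.ofHom (LinearMap.ker (d n)).subtype) (ModuleCat.ofHom (π n)) <| by
      ext x
      exact x.2
  have hS (n : ℤ) : (S n).ShortExact := by
    refine ModuleCat.shortComplex_shortExact _ (fun x ↦ ?_) Subtype.val_injective fun z ↦ ?_
    · exact ⟨fun h ↦ ⟨⟨x, congrArg Subtype.val h⟩, rfl⟩, by rintro ⟨y, rfl⟩; exact Subtype.ext y.2⟩
    · obtain ⟨w, hw⟩ := (hd n z.1).mp z.2
      exact ⟨w, Subtype.ext hw⟩
  induction p with
  | zero =>
    intro n t e
    have := hI n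
    obtain ⟨e₃, rfl⟩ := Abelian.Ext.covariant_sequence_exact₁ _ (hS n) e
      (Abelian.Ext.eq_zero_of_injective (I := I n) _) (zero_add 1)
    obtain ⟨f, rfl⟩ := Abelian.Ext.homEquiv₀.symm.surjective e₃
    let z : LinearMap.ker (d (n - 1)) := f.hom (Ideal.Quotient.mk _ 1)
    have hz : ∀ r ∈ J ^ t, r • z = 0 := by
      intro r hr
      have hr' : (Ideal.Quotient.mk (J ^ t) r) = 0 := Ideal.Quotient.eq_zero_iff_mem.mpr hr
      have : r • (Ideal.Quotient.mk (J ^ t) 1) = 0 := by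
        rw [← hr', Algebra.smul_def, map_one, mul_one]
        rfl
      rw [← map_smul, this, map_zero]
    obtain ⟨w, hw, s, hs⟩ := exists_ideal_torsion_preimage J (fun n ↦ I n) d
      (fun n ↦ (Module.injective_iff_injective_object R (I n)).mpr (hI n)) hd n z.1 z.2 t
      fun r hr ↦ congrArg Subtype.val (hz r hr)
    have hts : t ≤ s + t := Nat.le_add_left t s
    let g : ModuleCat.of R (R ⧸ J ^ (s + t)) ⟶ I n :=
      ModuleCat.ofHom (Submodule.liftQ _ (LinearMap.toSpanSingleton R (I n) w) fun r hr ↦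
        hs r (Ideal.pow_le_pow_right (Nat.le_add_right s t) hr))
    have hg : powQuotientMap J hts ≫ f = g ≫ (S n).g := by
      ext
      change z.1 = d n ((1 : R) • w)
      rw [one_smul, hw]
    refine ⟨s + t, hts, ?_⟩
    rw [Abelian.Ext.homEquiv₀_symm_apply, Abelian.Ext.mk₀_comp_mk₀_assoc, hg,
      ← Abelian.Ext.mk₀_comp_mk₀_assoc, (hS n).comp_extClass, Abelian.Ext.comp_zero]
  | succ p ih =>
    intro n
    have := hI n
    exact .of_shortExact (hS n) (ih (n - 1)) (.of_injective J (I n) (p + 1))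

lemma IsGorensteinInjective.extColimVanishes {R : Type u} [CommRing R] [IsNoetherianRing R]
    (J : Ideal R) {G : ModuleCat.{u} R} (hG : IsGorensteinInjective R G) (p : ℕ) :
    ExtColimVanishes J G (p + 1) := by
  obtain ⟨I, d, hI, hd, -, ⟨φ⟩⟩ := hG
  exact (extColimVanishes_ker J I d hI hd p 0).of_iso φ.symm.toModuleIso

lemma HasGidLE.extColimVanishes {R : Type u} [CommRing R] [IsNoetherianRing R] (J : Ideal R)
    (n : ℕ) : ∀ (M : Type u) [AddCommGroup M] [Module R M] (_ : HasGidLE R M n) (p : ℕ),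
      ExtColimVanishes J (ModuleCat.of R M) (n + p + 1) := by
  induction n with
  | zero =>
    rintro M _ _ ⟨G, e, d, hG, he, hed, -, h0⟩ p
    have := h0 1 zero_lt_one
    have hbij : Function.Bijective e :=
      ⟨he, fun x ↦ (hed x).mp (Subsingleton.elim _ _)⟩
    rw [zero_add]
    exact ((hG 0).extColimVanishes J p).of_iso (LinearEquiv.ofBijective e hbij).symm.toModuleIso
  | succ n ih =>
    rintro M _ _ ⟨G, e, d, hG, he, hed, hd, h0⟩ p
    let π : G 0 →ₗ[R] LinearMap.ker (d 1) :=
      (d 0).codRestrict _ fun x ↦ (hd 0).apply_apply_eq_zero x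
    let S : ShortComplex (ModuleCat.{u} R) :=
      .mk (ModuleCat.ofHom e) (ModuleCat.ofHom π) <| by
        ext x
        exact hed.apply_apply_eq_zero x
    have hS : S.ShortExact := by
      refine ModuleCat.shortComplex_shortExact _ (fun x ↦ ?_) he fun z ↦ ?_
      · exact Iff.trans ⟨congrArg Subtype.val, fun h ↦ Subtype.ext h⟩ (hed x)
      · obtain ⟨w, hw⟩ := (hd 0 z.1).mp z.2
        exact ⟨w, Subtype.ext hw⟩
    have hC : HasGidLE R (LinearMap.ker (d 1)) n :=
      ⟨fun i ↦ G (i + 1), (LinearMap.ker (d 1)).subtype, fun i ↦ d (i + 1), fun i ↦ hG _,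
        Subtype.val_injective, LinearMap.exact_subtype_ker_map _, fun i ↦ hd _,
        fun i hi ↦ h0 _ (by omega)⟩
    rw [show n + 1 + p + 1 = n + p + 1 + 1 by omega]
    exact .of_shortExact hS (ih _ hC p) ((hG 0).extColimVanishes J (n + p + 1))

theorem localCohomology_subsingleton_of_gt_gid (R S : Type u) [CommRing R] [CommRing S] [IsNoetherianRing R] [IsNoetherianRing S]
    [IsLocalRing R] [IsLocalRing S] [Algebra R S] [IsLocalHom (algebraMap R S)]
    (M : Type u) [AddCommGroup M] [Module S M] [Module R M] [IsScalarTower R S M] [Module.Finite S M]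
    (i : ℕ) (hi : Gid R M < (i : ℕ∞)) :
    Subsingleton ((localCohomology (IsLocalRing.maximalIdeal R) i).obj (ModuleCat.of R M)) := by
  obtain ⟨_, ⟨n, rfl, hn⟩, hni⟩ := sInf_lt_iff.mp hi
  obtain ⟨p, rfl⟩ := Nat.exists_eq_add_of_lt (ENat.natCast_lt_natCast.mp hni)
  exact (hn.extColimVanishes (maximalIdeal R) n M p).subsingleton_localCohomology

end
end

section
/- Let R be an almost Cohen-Macaulay noetherian local ring (dim R − depth R ≤ 1). Then for prime ideals p ⊆ q of R, depth R_p ≤ depth R_q. -/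
open CategoryTheory IsLocalRing

universe u

noncomputable section

section Depth

open RingTheory.Sequence Abelian Pointwise

variable {R : Type u} [CommRing R] [IsNoetherianRing R]

/-- An associated prime of a module contains no regular element. -/
lemma IsAssociatedPrime.notMem_of_isSMulRegular {M : Type*} [AddCommGroup M] [Module R M]
    {p : Ideal R} (hp : IsAssociatedPrime p M) {x : R} (hreg : IsSMulRegular M x) : x ∉ p := by
  obtain ⟨hprime, y, hy⟩ := isAssociatedPrime_iff.mp hp
  intro hxp
  have hxy := hy.le hxp
  rw [Submodule.mem_colon_singleton, Submodule.mem_bot] at hxy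
  refine hprime.ne_top (hy.trans ((Ideal.eq_top_iff_one _).mpr ?_))
  simp [Submodule.mem_colon_singleton, hreg.right_eq_zero_of_smul hxy]

variable [IsLocalRing R]

/-- If `x ∈ 𝔪` is `M`-regular and `p` is an associated prime of `M`, then `M ⧸ xM` has an
associated prime containing both `p` and `x`. -/
lemma exists_associatedPrime_quotSMulTop {M : Type*} [AddCommGroup M] [Module R M]
    [Module.Finite R M] {x : R} (hx : x ∈ maximalIdeal R) (hreg : IsSMulRegular M x)
    {p : Ideal R} (hp : IsAssociatedPrime p M) :
    ∃ p' : Ideal R, IsAssociatedPrime p' (QuotSMulTop x M) ∧ p ≤ p' ∧ x ∈ p' := by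
  obtain ⟨hprime, y, hy⟩ := isAssociatedPrime_iff.mp hp
  let N : Submodule R M := Submodule.torsionBySet R M p
  have hyN : y ∈ N := by
    rw [Submodule.mem_torsionBySet_iff]
    rintro ⟨a, ha⟩
    have ha' := hy.le ha
    rwa [Submodule.mem_colon_singleton, Submodule.mem_bot] at ha'
  have hN : ¬ N ≤ x • (⊤ : Submodule R M) := by
    intro hle
    have hNx : N ≤ Ideal.span {x} • N := by
      intro z hz
      obtain ⟨w, -, rfl⟩ := (Submodule.mem_smul_pointwise_iff_exists _ _ _).mp (hle hz)
      refine Submodule.smul_mem_smul (Ideal.mem_span_singleton_self x) ?_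
      rw [Submodule.mem_torsionBySet_iff] at hz ⊢
      intro a
      refine hreg.right_eq_zero_of_smul ?_
      rw [smul_comm, hz a]
    have hbot := Submodule.eq_bot_of_le_smul_of_le_jacobson_bot _ N (IsNoetherian.noetherian N) hNx
      ((Ideal.span_singleton_le_iff_mem _).mpr (maximalIdeal_le_jacobson _ hx))
    rw [hbot, Submodule.mem_bot] at hyN
    refine hprime.ne_top (hy.trans ((Ideal.eq_top_iff_one _).mpr ?_))
    simp [Submodule.mem_colon_singleton, hyN]
  obtain ⟨z, hzN, hz⟩ := SetLike.not_le_iff_exists.mp hN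
  obtain ⟨p', hp', hle⟩ := exists_le_isAssociatedPrime_of_isNoetherianRing R
    (Submodule.Quotient.mk z : QuotSMulTop x M) (by rwa [ne_eq, Submodule.Quotient.mk_eq_zero])
  refine ⟨p', hp', fun a ha ↦ hle ?_, hle ?_⟩
  · rw [Submodule.mem_colon_singleton, Submodule.mem_bot, ← Submodule.Quotient.mk_smul,
      (Submodule.mem_torsionBySet_iff _ _).mp hzN ⟨a, ha⟩, Submodule.Quotient.mk_zero]
  · rw [Submodule.mem_colon_singleton, Submodule.mem_bot, ← Submodule.Quotient.mk_smul,
      Submodule.Quotient.mk_eq_zero]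
    exact Submodule.smul_mem_pointwise_smul _ _ _ trivial

/-- The length of an `M`-regular sequence is at most `dim R ⧸ p` for every associated prime `p`
of `M`. -/
lemma length_le_coheight_of_isAssociatedPrime {M : Type*} [AddCommGroup M] [Module R M]
    [Module.Finite R M] (rs : List R) (mem : ∀ r ∈ rs, r ∈ maximalIdeal R)
    (reg : IsWeaklyRegular M rs) (p : PrimeSpectrum R) (hp : IsAssociatedPrime p.asIdeal M) :
    (rs.length : ℕ∞) ≤ Order.coheight p := by
  induction rs generalizing M p with
  | nil => simp
  | cons x rs ih =>
    rw [isWeaklyRegular_cons_iff] at reg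
    simp only [List.mem_cons, forall_eq_or_imp] at mem
    obtain ⟨p', hp', hle, hxp'⟩ := exists_associatedPrime_quotSMulTop mem.1 reg.1 hp
    have hlt : p < ⟨p', hp'.isPrime⟩ :=
      lt_of_le_of_ne hle fun h ↦ hp.notMem_of_isSMulRegular reg.1 (h ▸ hxp')
    rw [List.length_cons, Nat.cast_add, Nat.cast_one]
    exact (add_le_add_left (ih mem.2 reg.2 ⟨p', hp'.isPrime⟩ hp') 1).trans
      (Order.coheight_add_one_le hlt)

/-- Dividing out a regular element of the maximal ideal lowers the depth by at most one. -/
lemma exists_isRegular_quotSMulTop {M : Type u} [AddCommGroup M] [Module R M]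
    [Module.Finite R M] [Nontrivial M] {n : ℕ}
    (h : ∃ rs : List R, rs.length = n + 1 ∧ (∀ r ∈ rs, r ∈ maximalIdeal R) ∧ IsRegular M rs)
    {x : R} (hx : x ∈ maximalIdeal R) (hreg : IsSMulRegular M x) :
    ∃ rs : List R, rs.length = n ∧ (∀ r ∈ rs, r ∈ maximalIdeal R) ∧
      IsRegular (QuotSMulTop x M) rs := by
  have smul_lt (L : Type u) [AddCommGroup L] [Module R L] [Module.Finite R L] [Nontrivial L] :
      maximalIdeal R • (⊤ : Submodule R L) < ⊤ :=
    (Submodule.top_ne_ideal_smul_of_le_jacobson_annihilator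
      (maximalIdeal_le_jacobson _)).symm.lt_top
  have : Nontrivial (QuotSMulTop x M) := nontrivial_quotSMulTop_of_mem_maximalIdeal _ hx
  have hM := ((ModuleCat.exists_isRegular_tfae (maximalIdeal R) (n + 1) (ModuleCat.of R M)
    (smul_lt M)).out 1 3).mpr h
  refine ((ModuleCat.exists_isRegular_tfae (maximalIdeal R) n
    (ModuleCat.of R (QuotSMulTop x M)) (smul_lt _)).out 1 3).mp fun i hi ↦ ?_
  have zero1 := AddCommGrpCat.isZero_of_iff_subsingleton.mpr (hM i (by omega))
  have zero2 := AddCommGrpCat.isZero_of_iff_subsingleton.mpr (hM (i + 1) (by omega))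
  exact AddCommGrpCat.subsingleton_of_isZero <| ShortComplex.Exact.isZero_of_both_zeros
    (Ext.covariant_sequence_exact₃' _
      (IsSMulRegular.smulShortComplex_shortExact (M := ModuleCat.of R M) hreg) i (i + 1) rfl)
    (zero1.eq_zero_of_src _) (zero2.eq_zero_of_tgt _)

/-- The inequality `depth M ≤ grade (q, M) + dim R ⧸ q`. -/
lemma exists_isWeaklyRegular_length_le_add_coheight (q : PrimeSpectrum R) (n : ℕ) {M : Type u}
    [AddCommGroup M] [Module R M] [Module.Finite R M] [Nontrivial M]
    (h : ∃ rs : List R, rs.length = n ∧ (∀ r ∈ rs, r ∈ maximalIdeal R) ∧ IsRegular M rs) :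
    ∃ ts : List R, (∀ t ∈ ts, t ∈ q.asIdeal) ∧ IsWeaklyRegular M ts ∧
      (n : ℕ∞) ≤ ts.length + Order.coheight q := by
  induction n generalizing M with
  | zero => exact ⟨[], by simp, .nil R M, by simp⟩
  | succ n ih =>
    by_cases hq : ∃ p, IsAssociatedPrime p M ∧ q.asIdeal ≤ p
    · obtain ⟨p, hp, hqp⟩ := hq
      obtain ⟨rs, hlen, mem, reg⟩ := h
      refine ⟨[], by simp, .nil R M, ?_⟩
      rw [← hlen, List.length_nil, Nat.cast_zero, zero_add]
      exact (length_le_coheight_of_isAssociatedPrime rs mem reg.1 ⟨p, hp.isPrime⟩ hp).trans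
        (Order.coheight_anti hqp)
    · have hsub : ¬ (q.asIdeal : Set R) ⊆ ⋃ p ∈ associatedPrimes R M, (p : Set R) := fun hle ↦
        hq <| (Ideal.subset_union_prime_finite (associatedPrimes.finite R M) (f := id) 0 0
          fun _ h _ _ ↦ h.isPrime).mp hle
      rw [biUnion_associatedPrimes_eq_zero_divisors, Set.not_subset] at hsub
      obtain ⟨x, hxq, hx⟩ := hsub
      have hreg : IsSMulRegular M x := .of_right_eq_zero_of_smul fun m hm ↦
        by_contra fun hm0 ↦ hx ⟨m, hm0, hm⟩
      have hxm : x ∈ maximalIdeal R := le_maximalIdeal q.isPrime.ne_top hxq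
      have : Nontrivial (QuotSMulTop x M) := nontrivial_quotSMulTop_of_mem_maximalIdeal _ hxm
      obtain ⟨ts, mem, reg, hle⟩ := ih (exists_isRegular_quotSMulTop h hxm hreg)
      refine ⟨x :: ts, by simpa using ⟨hxq, mem⟩, .cons hreg reg, ?_⟩
      rw [List.length_cons, Nat.cast_add, Nat.cast_add, Nat.cast_one, add_right_comm]
      exact add_le_add_left hle 1

lemma ringDepth_le_ringDepth_localization_add_coheight (q : Ideal R) [hq : q.IsPrime] :
    ringDepth R ≤
      ringDepth (Localization.AtPrime q) + Order.coheight (⟨q, hq⟩ : PrimeSpectrum R) := by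
  refine sSup_le ?_
  rintro _ ⟨rs, rfl, mem, reg⟩
  obtain ⟨ts, hts, tsreg, hle⟩ := exists_isWeaklyRegular_length_le_add_coheight ⟨q, hq⟩ rs.length
    ⟨rs, rfl, mem, reg⟩
  refine hle.trans (add_le_add_left ?_ _)
  refine le_sSup ⟨ts.map (algebraMap R (Localization.AtPrime q)), by simp, ?_,
    tsreg.isRegular_of_isLocalization_of_mem _ q hts⟩
  intro y hy
  obtain ⟨t, ht, rfl⟩ := List.mem_map.mp hy
  exact (IsLocalization.AtPrime.to_map_mem_maximal_iff _ q t).mpr (hts t ht)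

lemma ringDepth_le_ringKrullDim : (ringDepth R : WithBot ℕ∞) ≤ ringKrullDim R := by
  rw [← maximalIdeal_height_eq_ringKrullDim, WithBot.coe_le_coe]
  refine sSup_le ?_
  rintro _ ⟨rs, rfl, mem, reg⟩
  rw [← WithBot.coe_le_coe, maximalIdeal_height_eq_ringKrullDim,
    ← ringKrullDim_add_length_eq_ringKrullDim_of_isRegular rs reg]
  have : Nontrivial (R ⧸ Ideal.ofList rs) :=
    Ideal.Quotient.nontrivial_iff.mpr fun h ↦ reg.top_ne_smul (by simp [h])
  exact le_add_of_nonneg_left ringKrullDim_nonneg_of_nontrivial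

/-- Localizations of an almost Cohen-Macaulay local ring are almost Cohen-Macaulay. -/
lemma height_le_ringDepth_localization_add_one
    (hacm : ringKrullDim R ≤ ((ringDepth R + 1 : ℕ∞) : WithBot ℕ∞))
    (q : Ideal R) [hq : q.IsPrime] : q.height ≤ ringDepth (Localization.AtPrime q) + 1 := by
  let Q : PrimeSpectrum R := ⟨q, hq⟩
  have hdim : ((Order.height Q + Order.coheight Q : ℕ∞) : WithBot ℕ∞) ≤ ringKrullDim R := by
    rw [ringKrullDim, Order.krullDim_eq_iSup_height_add_coheight_of_nonempty, WithBot.coe_le_coe]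
    exact le_iSup (fun a : PrimeSpectrum R ↦ Order.height a + Order.coheight a) Q
  have hfin : Order.coheight Q ≠ ⊤ := fun h ↦ by
    rw [h, add_top, ← maximalIdeal_height_eq_ringKrullDim, WithBot.coe_le_coe, top_le_iff] at hdim
    exact Ideal.height_ne_top Ideal.IsPrime.ne_top' hdim
  rw [← ENat.add_le_add_iff_right hfin, PrimeSpectrum.height_eq_orderHeight Q, add_right_comm]
  exact (WithBot.coe_le_coe.mp (hdim.trans hacm)).trans
    (add_le_add_left (ringDepth_le_ringDepth_localization_add_coheight q) 1)

end Depth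

theorem depth_monotone_of_almost_cohenMacaulay (R : Type u) [CommRing R] [IsNoetherianRing R] [IsLocalRing R]
    (hacm : ringKrullDim R ≤ ((ringDepth R + 1 : ℕ∞) : WithBot ℕ∞))
    (p q : Ideal R) [p.IsPrime] [q.IsPrime] (hpq : p ≤ q) :
    ringDepth (Localization.AtPrime p) ≤ ringDepth (Localization.AtPrime q) := by
  obtain rfl | hlt := hpq.eq_or_lt
  · rfl
  have hp : ringDepth (Localization.AtPrime p) ≤ p.height := by
    rw [← WithBot.coe_le_coe,
      ← IsLocalization.AtPrime.ringKrullDim_eq_height p (Localization.AtPrime p)]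
    exact ringDepth_le_ringKrullDim
  refine hp.trans ((ENat.add_le_add_iff_right ENat.one_ne_top).mp ?_)
  exact (Ideal.height_add_one_le_of_lt_of_isPrime hlt).trans
    (height_le_ringDepth_localization_add_one hacm q)

end
end

section
/- Let (R,m) be a noetherian local ring and M an R-module finite over a local homomorphism. If x ∈ m is a non-zerodivisor on both R and M, then Gid_{R/xR}(M/xM) ≤ Gid_R(M) − 1, provided Gid_R(M) is finite. -/
open CategoryTheory IsLocalRing

universe u

noncomputable section

section LinearFactorization

variable {R : Type*} [Ring R] {A B C : Type*} [AddCommGroup A] [AddCommGroup B] [AddCommGroup C]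
  [Module R A] [Module R B] [Module R C]

lemma LinearMap.exists_comp_eq_of_injective {i : A →ₗ[R] B} (hi : Function.Injective i)
    (f : C →ₗ[R] B) (h : ∀ c, ∃ a, i a = f c) : ∃ g : C →ₗ[R] A, ∀ c, i (g c) = f c := by
  refine ⟨(LinearEquiv.ofInjective i hi).symm.toLinearMap ∘ₗ f.codRestrict (LinearMap.range i) h,
    fun c => ?_⟩
  have := (LinearEquiv.ofInjective i hi).apply_symm_apply (f.codRestrict (LinearMap.range i) h c)
  exact congrArg Subtype.val this

lemma LinearMap.exists_comp_eq_of_surjective {p : A →ₗ[R] B} (hp : Function.Surjective p)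
    (f : A →ₗ[R] C) (h : ∀ a, p a = 0 → f a = 0) : ∃ g : B →ₗ[R] C, ∀ a, g (p a) = f a := by
  have h' : LinearMap.ker p ≤ LinearMap.ker f := fun a ha => h a ha
  refine ⟨(LinearMap.ker p).liftQ f h' ∘ₗ (p.quotKerEquivOfSurjective hp).symm.toLinearMap,
    fun a => ?_⟩
  have : (p.quotKerEquivOfSurjective hp).symm (p a) = (LinearMap.ker p).mkQ a := by
    rw [LinearEquiv.symm_apply_eq]; rfl
  rw [LinearMap.comp_apply, LinearEquiv.coe_coe, this, Submodule.mkQ_apply, Submodule.liftQ_apply]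

end LinearFactorization

/-- `0 → A → B → C → 0` is exact. -/
structure IsShortExactSeq {R : Type*} [Ring R] {A B C : Type*} [AddCommGroup A] [AddCommGroup B]
    [AddCommGroup C] [Module R A] [Module R B] [Module R C] (i : A →ₗ[R] B) (p : B →ₗ[R] C) :
    Prop where
  inj : Function.Injective i
  exact : Function.Exact i p
  surj : Function.Surjective p

namespace IsShortExactSeq

variable {R : Type*} [Ring R] {A B C : Type*} [AddCommGroup A] [AddCommGroup B] [AddCommGroup C]
  [Module R A] [Module R B] [Module R C]

lemma of_surjective {p : B →ₗ[R] C} (hp : Function.Surjective p) :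
    IsShortExactSeq (LinearMap.ker p).subtype p :=
  ⟨Subtype.val_injective, fun b => ⟨fun h => ⟨⟨b, h⟩, rfl⟩, by rintro ⟨y, rfl⟩; exact y.2⟩, hp⟩

lemma of_injective {i : A →ₗ[R] B} (hi : Function.Injective i) :
    IsShortExactSeq i (LinearMap.range i).mkQ :=
  ⟨hi, fun b => by simp, Submodule.mkQ_surjective _⟩

end IsShortExactSeq

section GorensteinInjective

variable {R : Type u} [CommRing R]

/-- Every map from an injective module to the target of `p` factors through `p`. -/
def LiftsInjectives {B C : Type u} [AddCommGroup B] [AddCommGroup C] [Module R B] [Module R C]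
    (p : B →ₗ[R] C) : Prop :=
  ∀ (J : Type u) [AddCommGroup J] [Module R J], Module.Injective R J →
    ∀ f : J →ₗ[R] C, ∃ g : J →ₗ[R] B, ∀ y, p (g y) = f y

variable (R) in
/-- `Ext¹(J, A) = 0` for all injective modules `J`, phrased through lifting of maps. -/
def InjectiveExtVanishing (A : Type u) [AddCommGroup A] [Module R A] : Prop :=
  ∀ (B C : Type u) [AddCommGroup B] [AddCommGroup C] [Module R B] [Module R C]
    (i : A →ₗ[R] B) (p : B →ₗ[R] C), IsShortExactSeq i p → LiftsInjectives p

variable (R) in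
/-- There is a short exact sequence `0 → K → I → G → 0` with `I` injective, which stays exact
under `Hom(J, -)` for all injective modules `J`. -/
def InjectiveStep (K G : Type u) [AddCommGroup K] [AddCommGroup G] [Module R K] [Module R G] :
    Prop :=
  ∃ (I : ModuleCat.{u} R) (i : K →ₗ[R] I) (p : I →ₗ[R] G),
    Module.Injective R I ∧ IsShortExactSeq i p ∧ LiftsInjectives p

lemma InjectiveStep.congr {K G K' G' : Type u} [AddCommGroup K] [AddCommGroup G] [Module R K]
    [Module R G] [AddCommGroup K'] [AddCommGroup G'] [Module R K'] [Module R G']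
    (h : InjectiveStep R K G) (e : K' ≃ₗ[R] K) (e' : G ≃ₗ[R] G') : InjectiveStep R K' G' := by
  obtain ⟨I, i, p, hI, hs, hl⟩ := h
  refine ⟨I, i ∘ₗ e.toLinearMap, e'.toLinearMap ∘ₗ p, hI,
    ⟨hs.inj.comp e.injective, fun y => ?_, e'.surjective.comp hs.surj⟩, fun J _ _ hJ f => ?_⟩
  · have := hs.exact y
    simp only [LinearMap.comp_apply, LinearEquiv.coe_coe, map_eq_zero_iff e' e'.injective, this]
    constructor
    · rintro ⟨k, rfl⟩
      exact ⟨e.symm k, by simp⟩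
    · rintro ⟨k, rfl⟩
      exact ⟨e k, rfl⟩
  · obtain ⟨g, hg⟩ := hl J hJ (e'.symm.toLinearMap ∘ₗ f)
    exact ⟨g, fun y => by simp [hg]⟩

/-- A class of modules in which every member continues to the left and to the right by an
`InjectiveStep` inside the class. -/
def IsStepStable (𝒢 : ModuleCat.{u} R → Prop) : Prop :=
  ∀ G, 𝒢 G → (∃ K, 𝒢 K ∧ InjectiveStep R K G) ∧ (∃ Q, 𝒢 Q ∧ InjectiveStep R G Q)

lemma IsStepStable.exists_chain {𝒢 : ModuleCat.{u} R → Prop} (h : IsStepStable 𝒢)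
    {G : ModuleCat.{u} R} (hG : 𝒢 G) :
    ∃ Z : ℤ → ModuleCat.{u} R, Z 0 = G ∧ ∀ n, InjectiveStep R (Z n) (Z (n - 1)) := by
  choose l hl hl' using fun X : {X // 𝒢 X} => (h X.1 X.2).1
  choose r hr hr' using fun X : {X // 𝒢 X} => (h X.1 X.2).2
  let left : ℕ → {X // 𝒢 X} := fun n => n.rec ⟨G, hG⟩ fun _ X => ⟨l X, hl X⟩
  let right : ℕ → {X // 𝒢 X} := fun n => n.rec ⟨G, hG⟩ fun _ X => ⟨r X, hr X⟩
  have left_step : ∀ n, InjectiveStep R (left (n + 1)).1 (left n).1 := fun n =>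
    hl' (left n)
  have right_step : ∀ n, InjectiveStep R (right n).1 (right (n + 1)).1 := fun n =>
    hr' (right n)
  refine ⟨fun | .ofNat n => (left n).1 | .negSucc n => (right (n + 1)).1, rfl, ?_⟩
  rintro ((_ | n) | n)
  · exact right_step 0
  · rw [show Int.ofNat (n + 1) - 1 = Int.ofNat n by simp]
    exact left_step n
  · rw [show Int.negSucc n - 1 = Int.negSucc (n + 1) by omega]
    exact right_step (n + 1)

lemma IsStepStable.isGorensteinInjective {𝒢 : ModuleCat.{u} R → Prop} (h : IsStepStable 𝒢)
    {G : ModuleCat.{u} R} (hG : 𝒢 G) : IsGorensteinInjective R G := by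
  obtain ⟨Z, rfl, hZ⟩ := h.exists_chain hG
  choose I i p hI hs hl using hZ
  have hd : ∀ n y, i (n - 1) (p n y) = 0 ↔ p n y = 0 := fun n y =>
    map_eq_zero_iff _ (hs (n - 1)).inj
  refine ⟨I, fun n => i (n - 1) ∘ₗ p n, fun n =>
    Module.injective_object_of_injective_module (inj := hI n), fun n y => ?_,
    fun J hJ n f => ?_, ⟨?_⟩⟩
  · simp only [LinearMap.comp_apply]
    rw [hd, (hs (n - 1)).exact y]
    constructor
    · rintro ⟨z, rfl⟩
      obtain ⟨w, rfl⟩ := (hs n).surj z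
      exact ⟨w, rfl⟩
    · rintro ⟨w, rfl⟩
      exact ⟨p n w, rfl⟩
  · constructor
    · intro hf
      have hf' : ∀ y, ∃ z, i (n - 1) z = f y := fun y => by
        have := LinearMap.congr_fun hf y
        exact ((hs (n - 1)).exact (f y)).1 ((hd _ _).1 this)
      obtain ⟨g, hg⟩ := LinearMap.exists_comp_eq_of_injective (hs (n - 1)).inj f hf'
      obtain ⟨k, hk⟩ := hl n J (Module.injective_module_of_injective_object (inj := hJ)) g
      exact ⟨k, LinearMap.ext fun y => by simp [hk, hg]⟩
    · rintro ⟨g, rfl⟩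
      ext y
      have : p (n - 1) (i (n - 1) (p n (g y))) = 0 := ((hs (n - 1)).exact _).2 ⟨_, rfl⟩
      simp [this]
  · refine LinearEquiv.ofBijective ((i 0).codRestrict _ fun z => ?_) ⟨fun a b hab => ?_, ?_⟩
    · exact (hd 0 _).2 (((hs 0).exact _).2 ⟨z, rfl⟩)
    · exact (hs 0).inj (congrArg Subtype.val hab)
    · rintro ⟨y, hy⟩
      obtain ⟨z, rfl⟩ := ((hs 0).exact _).1 ((hd 0 _).1 hy)
      exact ⟨z, rfl⟩

lemma IsGorensteinInjective.exists_isStepStable {G : Type u} [AddCommGroup G] [Module R G]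
    (h : IsGorensteinInjective R G) :
    ∃ 𝒢 : ModuleCat.{u} R → Prop, IsStepStable 𝒢 ∧ 𝒢 (ModuleCat.of R G) := by
  obtain ⟨I, d, hI, hd, hJ, ⟨e⟩⟩ := h
  have step : ∀ m n, m - 1 = n →
      InjectiveStep R (LinearMap.ker (d m)) (LinearMap.ker (d n)) := by
    rintro m _ rfl
    refine ⟨I m, (LinearMap.ker (d m)).subtype,
      (d m).codRestrict _ fun y => ((hd m _).2 ⟨y, rfl⟩),
      Module.injective_module_of_injective_object (inj := hI m),
      ⟨Subtype.val_injective, fun y => ?_, ?_⟩, fun J _ _ hJ' f => ?_⟩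
    · rw [← Subtype.val_inj]
      exact ⟨fun h => ⟨⟨y, h⟩, rfl⟩, by rintro ⟨y, rfl⟩; exact y.2⟩
    · rintro ⟨y, hy⟩
      obtain ⟨z, rfl⟩ := (hd m y).1 hy
      exact ⟨z, rfl⟩
    · obtain ⟨g, hg⟩ := (hJ (ModuleCat.of R J)
        (Module.injective_object_of_injective_module (inj := hJ')) m
        ((LinearMap.ker (d (m - 1))).subtype ∘ₗ f)).1 (LinearMap.ext fun y => (f y).2)
      exact ⟨g, fun y => Subtype.ext (LinearMap.congr_fun hg y)⟩
  refine ⟨fun X => ∃ n, Nonempty (X ≃ₗ[R] LinearMap.ker (d n)), ?_, 0, ⟨e⟩⟩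
  rintro X ⟨n, ⟨f⟩⟩
  exact ⟨⟨ModuleCat.of R (LinearMap.ker (d (n + 1))), ⟨n + 1, ⟨.refl _ _⟩⟩,
      (step (n + 1) n (by ring)).congr (.refl _ _) f.symm⟩,
    ⟨ModuleCat.of R (LinearMap.ker (d (n - 1))), ⟨n - 1, ⟨.refl _ _⟩⟩,
      (step n (n - 1) rfl).congr f (.refl _ _)⟩⟩

lemma isStepStable_isGorensteinInjective :
    IsStepStable fun G : ModuleCat.{u} R => IsGorensteinInjective R G := by
  intro G hG
  obtain ⟨𝒢, h𝒢, hG⟩ := IsGorensteinInjective.exists_isStepStable hG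
  obtain ⟨⟨K, hK, hKG⟩, ⟨Q, hQ, hGQ⟩⟩ := h𝒢 _ hG
  exact ⟨⟨K, h𝒢.isGorensteinInjective hK, hKG⟩, ⟨Q, h𝒢.isGorensteinInjective hQ, hGQ⟩⟩

section

variable {G : Type u} [AddCommGroup G] [Module R G]

lemma IsGorensteinInjective.exists_step_left (h : IsGorensteinInjective R G) :
    ∃ K : ModuleCat.{u} R, IsGorensteinInjective R K ∧ InjectiveStep R K G :=
  (isStepStable_isGorensteinInjective (ModuleCat.of R G) h).1

lemma IsGorensteinInjective.exists_step_right (h : IsGorensteinInjective R G) :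
    ∃ Q : ModuleCat.{u} R, IsGorensteinInjective R Q ∧ InjectiveStep R G Q :=
  (isStepStable_isGorensteinInjective (ModuleCat.of R G) h).2

lemma IsGorensteinInjective.congr {G' : Type u} [AddCommGroup G'] [Module R G']
    (h : IsGorensteinInjective R G) (e : G' ≃ₗ[R] G) : IsGorensteinInjective R G' := by
  obtain ⟨I, d, h₁, h₂, h₃, ⟨f⟩⟩ := h
  exact ⟨I, d, h₁, h₂, h₃, ⟨e.trans f⟩⟩

lemma IsGorensteinInjective.of_steps {K Q : Type u} [AddCommGroup K] [AddCommGroup Q] [Module R K]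
    [Module R Q] (hK : IsGorensteinInjective R K) (hKG : InjectiveStep R K G)
    (hQ : IsGorensteinInjective R Q) (hGQ : InjectiveStep R G Q) : IsGorensteinInjective R G := by
  refine IsStepStable.isGorensteinInjective
    (𝒢 := fun X => IsGorensteinInjective R X ∨ X = ModuleCat.of R G) ?_
    (G := ModuleCat.of R G) (.inr rfl)
  rintro X (hX | rfl)
  · obtain ⟨⟨K, hK, hKG⟩, ⟨Q, hQ, hGQ⟩⟩ := isStepStable_isGorensteinInjective X hX
    exact ⟨⟨K, .inl hK, hKG⟩, ⟨Q, .inl hQ, hGQ⟩⟩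
  · exact ⟨⟨ModuleCat.of R K, .inl hK, hKG⟩, ⟨ModuleCat.of R Q, .inl hQ, hGQ⟩⟩

lemma Module.injective_of_subsingleton [Subsingleton G] : Module.Injective R G :=
  ⟨fun _ _ _ _ _ _ _ _ _ => ⟨0, fun _ => Subsingleton.elim _ _⟩⟩

lemma IsGorensteinInjective.of_injective (h : Module.Injective R G) :
    IsGorensteinInjective R G := by
  refine IsStepStable.isGorensteinInjective (𝒢 := fun X => Module.Injective R X) ?_
    (G := ModuleCat.of R G) h
  intro X hX
  refine ⟨⟨ModuleCat.of R PUnit, Module.injective_of_subsingleton, X, 0, .id, hX,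
      ⟨Function.injective_of_subsingleton _, fun y => ?_, Function.surjective_id⟩,
      fun J _ _ _ f => ⟨f, fun y => rfl⟩⟩,
    ⟨ModuleCat.of R PUnit, Module.injective_of_subsingleton, X, .id, 0, hX,
      ⟨Function.injective_id, fun y => by simp, Function.surjective_to_subsingleton _⟩,
      fun J _ _ _ f => ⟨0, fun y => Subsingleton.elim _ _⟩⟩⟩
  simp [eq_comm]

/-- Maps into a Gorenstein injective module extend along monomorphisms with injective cokernel. -/
lemma IsGorensteinInjective.exists_extension (h : IsGorensteinInjective R G) {A B C : Type u}
    [AddCommGroup A] [AddCommGroup B] [AddCommGroup C] [Module R A] [Module R B] [Module R C]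
    {i : A →ₗ[R] B} {p : B →ₗ[R] C} (hs : IsShortExactSeq i p) (hC : Module.Injective R C)
    (f : A →ₗ[R] G) : ∃ g : B →ₗ[R] G, ∀ a, g (i a) = f a := by
  obtain ⟨Q, -, I, j, q, hI, hj, hq⟩ := h.exists_step_right
  obtain ⟨g, hg⟩ := hI.out i hs.inj (j ∘ₗ f)
  obtain ⟨k, hk⟩ := LinearMap.exists_comp_eq_of_surjective hs.surj (q ∘ₗ g) fun b hb => by
    obtain ⟨a, rfl⟩ := (hs.exact b).1 hb
    exact (hj.exact _).2 ⟨f a, (hg a).symm⟩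
  obtain ⟨l, hl⟩ := hq C hC k
  obtain ⟨m, hm⟩ := LinearMap.exists_comp_eq_of_injective hj.inj (g - l ∘ₗ p) fun b =>
    (hj.exact _).1 (by simp [hl, hk])
  refine ⟨m, fun a => hj.inj ?_⟩
  have : p (i a) = 0 := (hs.exact _).2 ⟨a, rfl⟩
  simp [hm, hg, this]

lemma IsGorensteinInjective.injectiveExtVanishing (h : IsGorensteinInjective R G) :
    InjectiveExtVanishing R G := by
  intro B C _ _ _ _ i p hs J _ _ hJ f
  obtain ⟨Q, -, I, j, q, hI, hj, hq⟩ := h.exists_step_right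
  obtain ⟨g, hg⟩ := hI.out i hs.inj j
  obtain ⟨k, hk⟩ := LinearMap.exists_comp_eq_of_surjective hs.surj (q ∘ₗ g) fun b hb => by
    obtain ⟨a, rfl⟩ := (hs.exact b).1 hb
    exact (hj.exact _).2 ⟨a, (hg a).symm⟩
  obtain ⟨l, hl⟩ := hq J hJ (k ∘ₗ f)
  have inj : Function.Injective (p.prod g) := by
    rw [injective_iff_map_eq_zero]
    intro b hb
    obtain ⟨h₁, h₂⟩ := Prod.mk_eq_zero.1 hb
    obtain ⟨a, rfl⟩ := (hs.exact b).1 h₁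
    rw [hg, map_eq_zero_iff _ hj.inj] at h₂
    simp [h₂]
  obtain ⟨m, hm⟩ := LinearMap.exists_comp_eq_of_injective inj (f.prod l) fun y => by
    obtain ⟨b, hb⟩ := hs.surj (f y)
    obtain ⟨a, ha⟩ := (hj.exact (l y - g b)).1 (by
      have := hk b
      simp_all)
    have : p (i a) = 0 := (hs.exact _).2 ⟨a, rfl⟩
    exact ⟨b + i a, by simp [this, hb, hg, ha]⟩
  exact ⟨m, fun y => congrArg Prod.fst (hm y)⟩

end

section

variable {A B C : Type u} [AddCommGroup A] [AddCommGroup B] [AddCommGroup C]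
  [Module R A] [Module R B] [Module R C]

lemma InjectiveExtVanishing.of_isShortExactSeq {i : A →ₗ[R] B} {p : B →ₗ[R] C}
    (hs : IsShortExactSeq i p) (hA : InjectiveExtVanishing R A)
    (hC : InjectiveExtVanishing R C) : InjectiveExtVanishing R B := by
  intro X Y _ _ _ _ j q hj J _ _ hJ f
  have hXA := IsShortExactSeq.of_injective (i := j ∘ₗ i) (hj.inj.comp hs.inj)
  set m := (LinearMap.range (j ∘ₗ i)).mkQ
  obtain ⟨q', hq'⟩ := LinearMap.exists_comp_eq_of_surjective hXA.surj q fun a ha => by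
    obtain ⟨a, rfl⟩ := (hXA.exact _).1 ha
    exact (hj.exact _).2 ⟨i a, rfl⟩
  obtain ⟨j', hj'⟩ := LinearMap.exists_comp_eq_of_surjective hs.surj (m ∘ₗ j) fun b hb => by
    obtain ⟨a, rfl⟩ := (hs.exact _).1 hb
    exact (hXA.exact _).2 ⟨a, rfl⟩
  have hs' : IsShortExactSeq j' q' := by
    refine ⟨(injective_iff_map_eq_zero _).2 fun c hc => ?_, fun z => ?_, fun y => ?_⟩
    · obtain ⟨b, rfl⟩ := hs.surj c
      rw [hj'] at hc
      obtain ⟨a, ha⟩ := (hXA.exact _).1 hc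
      rw [← hj.inj ha]
      exact (hs.exact _).2 ⟨a, rfl⟩
    · obtain ⟨w, rfl⟩ := hXA.surj z
      rw [hq']
      constructor
      · intro hw
        obtain ⟨b, rfl⟩ := (hj.exact _).1 hw
        exact ⟨p b, hj' b⟩
      · rintro ⟨c, hc⟩
        obtain ⟨b, rfl⟩ := hs.surj c
        rw [hj'] at hc
        rw [← hq', ← hc]
        exact (hq' _).trans ((hj.exact _).2 ⟨b, rfl⟩)
    · obtain ⟨w, rfl⟩ := hj.surj y
      exact ⟨m w, hq' w⟩
  obtain ⟨g, hg⟩ := hC _ _ _ _ hs' J hJ f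
  obtain ⟨k, hk⟩ := hA _ _ _ _ hXA J hJ g
  exact ⟨k, fun y => by rw [← hq', hk, hg]⟩

lemma InjectiveExtVanishing.fst (h : InjectiveExtVanishing R (A × B)) :
    InjectiveExtVanishing R A := by
  intro X Y _ _ _ _ j q hj J _ _ hJ f
  have hs : IsShortExactSeq (j.prodMap (.id : B →ₗ[R] B)) (q ∘ₗ LinearMap.fst R X B) := by
    refine ⟨hj.inj.prodMap Function.injective_id, fun z => ?_, fun y => ?_⟩
    · refine (hj.exact z.1).trans ⟨?_, ?_⟩
      · rintro ⟨a, ha⟩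
        exact ⟨(a, z.2), Prod.ext ha rfl⟩
      · rintro ⟨a, rfl⟩
        exact ⟨a.1, rfl⟩
    · obtain ⟨w, rfl⟩ := hj.surj y
      exact ⟨(w, 0), rfl⟩
  obtain ⟨g, hg⟩ := h _ _ _ _ hs J hJ f
  exact ⟨LinearMap.fst R X B ∘ₗ g, hg⟩

instance Module.Injective.prod [Module.Injective R A] [Module.Injective R B] :
    Module.Injective R (A × B) := by
  refine ⟨fun X Y _ _ _ _ i hi f => ?_⟩
  obtain ⟨g, hg⟩ := Module.Injective.out i hi (LinearMap.fst R A B ∘ₗ f)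
  obtain ⟨k, hk⟩ := Module.Injective.out i hi (LinearMap.snd R A B ∘ₗ f)
  exact ⟨g.prod k, fun y => Prod.ext (hg y) (hk y)⟩

/-- An extension of Gorenstein injective modules has a left step to such an extension. -/
lemma IsShortExactSeq.exists_step_left {i : A →ₗ[R] B} {p : B →ₗ[R] C}
    (hs : IsShortExactSeq i p) (hA : IsGorensteinInjective R A)
    (hC : IsGorensteinInjective R C) :
    ∃ (A' K C' : ModuleCat.{u} R) (i' : A' →ₗ[R] K) (p' : K →ₗ[R] C'), IsShortExactSeq i' p' ∧
      IsGorensteinInjective R A' ∧ IsGorensteinInjective R C' ∧ InjectiveStep R K B := by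
  obtain ⟨A', hA', I, j, q, hI, hj, -⟩ := hA.exists_step_left
  obtain ⟨C', hC', I', j', q', hI', hj', -⟩ := hC.exists_step_left
  obtain ⟨l, hl⟩ := hA.injectiveExtVanishing _ _ _ _ hs _ hI' q'
  let π : I × I' →ₗ[R] B := (i ∘ₗ q).coprod l
  have hπ : ∀ a c, π (a, c) = i (q a) + l c := fun a c => by simp [π]
  have hpπ : ∀ y, p (π y) = q' y.2 := fun y => by
    rw [← Prod.mk.eta (p := y), hπ, map_add, hl, (hs.exact _).2 ⟨_, rfl⟩, zero_add]
  have hπs : Function.Surjective π := fun b => by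
    obtain ⟨c, hc⟩ := hj'.surj (p b)
    obtain ⟨a, ha⟩ := (hs.exact (b - l c)).1 (by simp [hl, hc])
    obtain ⟨w, rfl⟩ := hj.surj a
    exact ⟨(w, c), by simp [hπ, ha]⟩
  have hK := IsShortExactSeq.of_surjective hπs
  have hqj : ∀ a, q (j a) = 0 := fun a => (hj.exact _).2 ⟨a, rfl⟩
  obtain ⟨α, hα⟩ := LinearMap.exists_comp_eq_of_injective hK.inj (LinearMap.inl R I I' ∘ₗ j)
    fun a => (hK.exact _).1 (by simp [hπ, hqj])
  obtain ⟨β, hβ⟩ := LinearMap.exists_comp_eq_of_injective hj'.inj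
    (LinearMap.snd R I I' ∘ₗ (LinearMap.ker π).subtype) fun y => (hj'.exact _).1 (by
      have := hpπ y.1
      rw [y.2, map_zero] at this
      exact this.symm)
  have hαβ : IsShortExactSeq α β := by
    refine ⟨fun a b hab => ?_, fun y => ?_, fun c => ?_⟩
    · have := hα a
      rw [hab, hα] at this
      exact hj.inj (congrArg Prod.fst this).symm
    · rw [← map_eq_zero_iff _ hj'.inj, hβ]
      constructor
      · intro hy
        have hy : y.1.2 = 0 := hy
        have h₁ : π (y.1.1, y.1.2) = 0 := y.2
        rw [hπ, hy, map_zero, add_zero, map_eq_zero_iff _ hs.inj] at h₁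
        obtain ⟨a, ha⟩ := (hj.exact _).1 h₁
        exact ⟨a, hK.inj ((hα a).trans (Prod.ext ha hy.symm))⟩
      · rintro ⟨a, rfl⟩
        exact congrArg Prod.snd (hα a)
    · obtain ⟨a, ha⟩ := (hs.exact (l (j' c))).1 (by rw [hl]; exact (hj'.exact _).2 ⟨c, rfl⟩)
      obtain ⟨w, rfl⟩ := hj.surj a
      refine ⟨⟨(-w, j' c), ?_⟩, hj'.inj ?_⟩
      · simp [hπ, ha]
      · rw [hβ]; rfl
  refine ⟨A', ModuleCat.of R (LinearMap.ker π), C', α, β, hαβ, hA', hC', ModuleCat.of R (I × I'),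
    _, π, inferInstanceAs (Module.Injective R (I × I')), hK, ?_⟩
  exact InjectiveExtVanishing.of_isShortExactSeq hαβ hA'.injectiveExtVanishing
    hC'.injectiveExtVanishing _ _ _ _ hK

/-- An extension of Gorenstein injective modules has a right step to such an extension. -/
lemma IsShortExactSeq.exists_step_right {i : A →ₗ[R] B} {p : B →ₗ[R] C}
    (hs : IsShortExactSeq i p) (hA : IsGorensteinInjective R A)
    (hC : IsGorensteinInjective R C) :
    ∃ (A' Q C' : ModuleCat.{u} R) (i' : A' →ₗ[R] Q) (p' : Q →ₗ[R] C'), IsShortExactSeq i' p' ∧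
      IsGorensteinInjective R A' ∧ IsGorensteinInjective R C' ∧ InjectiveStep R B Q := by
  obtain ⟨A', hA', I, j, q, hI, hj, -⟩ := hA.exists_step_right
  obtain ⟨C', hC', I', j', q', hI', hj', -⟩ := hC.exists_step_right
  obtain ⟨l, hl⟩ := hI.out i hs.inj j
  let ι : B →ₗ[R] I × I' := l.prod (j' ∘ₗ p)
  have hι : ∀ b, ι b = (l b, j' (p b)) := fun b => rfl
  have hpi : ∀ a, p (i a) = 0 := fun a => (hs.exact _).2 ⟨a, rfl⟩
  have hιi : ∀ a, ι (i a) = (j a, 0) := fun a => by simp [hι, hl, hpi]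
  have hιs : Function.Injective ι := (injective_iff_map_eq_zero _).2 fun b hb => by
    obtain ⟨a, rfl⟩ := (hs.exact b).1 (hj'.inj (by simpa [hι] using congrArg Prod.snd hb))
    rw [hιi] at hb
    rw [(map_eq_zero_iff _ hj.inj).1 (congrArg Prod.fst hb), map_zero]
  have hQ := IsShortExactSeq.of_injective hιs
  set π := (LinearMap.range ι).mkQ
  obtain ⟨α, hα⟩ := LinearMap.exists_comp_eq_of_surjective hj.surj (π ∘ₗ LinearMap.inl R I I')
    fun a ha => (hQ.exact _).2 (by
      obtain ⟨a, rfl⟩ := (hj.exact _).1 ha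
      exact ⟨i a, hιi a⟩)
  obtain ⟨β, hβ⟩ := LinearMap.exists_comp_eq_of_surjective hQ.surj (q' ∘ₗ LinearMap.snd R I I')
    fun y hy => by
      obtain ⟨b, rfl⟩ := (hQ.exact _).1 hy
      exact (hj'.exact _).2 ⟨p b, rfl⟩
  have hαβ : IsShortExactSeq α β := by
    refine ⟨(injective_iff_map_eq_zero _).2 fun a ha => ?_, fun y => ?_, fun c => ?_⟩
    · obtain ⟨a, rfl⟩ := hj.surj a
      rw [hα] at ha
      obtain ⟨b, hb⟩ := (hQ.exact _).1 ha
      obtain ⟨x, rfl⟩ := (hs.exact b).1 (hj'.inj (by simpa [hι] using congrArg Prod.snd hb))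
      rw [hιi] at hb
      exact (hj.exact _).2 ⟨x, congrArg Prod.fst hb⟩
    · obtain ⟨⟨a, c⟩, rfl⟩ := hQ.surj y
      rw [hβ]
      constructor
      · intro hc
        obtain ⟨z, hz⟩ := (hj'.exact _).1 hc
        obtain ⟨b, rfl⟩ := hs.surj z
        refine ⟨q (a - l b), (hα _).trans ?_⟩
        have : π (ι b) = 0 := (hQ.exact _).2 ⟨b, rfl⟩
        rw [LinearMap.comp_apply, ← sub_eq_zero, ← map_sub, ← neg_eq_zero, ← map_neg, ← this, hι]
        congr 1
        have hz : j' (p b) = c := hz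
        simp [hz]
      · rintro ⟨z, hz⟩
        obtain ⟨w, rfl⟩ := hj.surj z
        rw [hα] at hz
        rw [← hβ, ← hz]
        exact (hβ _).trans (map_zero q')
    · obtain ⟨w, rfl⟩ := hj'.surj c
      exact ⟨π (0, w), hβ _⟩
  refine ⟨A', ModuleCat.of R ((I × I') ⧸ LinearMap.range ι), C', α, β, hαβ, hA', hC',
    ModuleCat.of R (I × I'), ι, π, inferInstanceAs (Module.Injective R (I × I')), hQ, ?_⟩
  exact InjectiveExtVanishing.of_isShortExactSeq hs hA.injectiveExtVanishing
    hC.injectiveExtVanishing _ _ _ _ hQ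

lemma IsGorensteinInjective.of_isShortExactSeq {i : A →ₗ[R] B} {p : B →ₗ[R] C}
    (hs : IsShortExactSeq i p) (hA : IsGorensteinInjective R A)
    (hC : IsGorensteinInjective R C) : IsGorensteinInjective R B := by
  refine IsStepStable.isGorensteinInjective (𝒢 := fun X => ∃ (A C : ModuleCat.{u} R)
    (i : A →ₗ[R] X) (p : X →ₗ[R] C), IsShortExactSeq i p ∧
      IsGorensteinInjective R A ∧ IsGorensteinInjective R C) ?_ (G := ModuleCat.of R B)
    ⟨ModuleCat.of R A, ModuleCat.of R C, i, p, hs, hA, hC⟩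
  rintro X ⟨A, C, i, p, hs, hA, hC⟩
  obtain ⟨A', K, C', i', p', hs', hA', hC', hK⟩ := hs.exists_step_left hA hC
  obtain ⟨A'', Q, C'', i'', p'', hs'', hA'', hC'', hQ⟩ := hs.exists_step_right hA hC
  exact ⟨⟨K, ⟨A', C', i', p', hs', hA', hC'⟩, hK⟩, ⟨Q, ⟨A'', C'', i'', p'', hs'', hA'', hC''⟩, hQ⟩⟩

/-- The cokernel of a monomorphism of Gorenstein injective modules is Gorenstein injective. -/
lemma IsGorensteinInjective.of_isShortExactSeq_right {i : A →ₗ[R] B} {p : B →ₗ[R] C}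
    (hs : IsShortExactSeq i p) (hA : IsGorensteinInjective R A)
    (hB : IsGorensteinInjective R B) : IsGorensteinInjective R C := by
  obtain ⟨A', hA', I, j, q, hI, hj, -⟩ := hA.exists_step_right
  obtain ⟨l, hl⟩ := hI.out i hs.inj j
  have hpi : ∀ a, p (i a) = 0 := fun a => (hs.exact _).2 ⟨a, rfl⟩
  obtain ⟨r, hr⟩ := LinearMap.exists_comp_eq_of_surjective
    (p := p.prodMap (.id : I →ₗ[R] I)) (hs.surj.prodMap Function.surjective_id)
    (q ∘ₗ (LinearMap.snd R B I - l ∘ₗ LinearMap.fst R B I)) (by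
      rintro ⟨b, e⟩ hbe
      obtain ⟨hb, he⟩ := Prod.mk_eq_zero.1 hbe
      obtain ⟨a, rfl⟩ := (hs.exact _).1 hb
      have he : e = 0 := he
      exact (hj.exact _).2 ⟨-a, by simp [hl, he]⟩)
  have hP : IsShortExactSeq (p.prod l) r := by
    refine ⟨(injective_iff_map_eq_zero _).2 fun b hb => ?_, ?_, fun a => ?_⟩
    · obtain ⟨h₁, h₂⟩ := Prod.mk_eq_zero.1 hb
      obtain ⟨a, rfl⟩ := (hs.exact _).1 h₁
      rw [hl] at h₂
      rw [(map_eq_zero_iff _ hj.inj).1 h₂, map_zero]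
    · rintro ⟨c, e⟩
      obtain ⟨b, rfl⟩ := hs.surj c
      rw [show r (p b, e) = q (e - l b) from hr (b, e), hj.exact]
      constructor
      · rintro ⟨a, ha⟩
        exact ⟨b + i a, by simp [hl, ha, hpi]⟩
      · rintro ⟨b', hb'⟩
        obtain ⟨h₁, rfl⟩ := Prod.mk_inj.1 hb'
        obtain ⟨a, ha⟩ := (hs.exact (b' - b)).1 (by rw [map_sub, sub_eq_zero]; exact h₁)
        exact ⟨a, by simp [← hl, ha]⟩
    · obtain ⟨e, rfl⟩ := hj.surj a
      exact ⟨(0, e), by simpa using hr (0, e)⟩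
  have hCI : IsGorensteinInjective R (C × I) := .of_isShortExactSeq hP hB hA'
  have hC : InjectiveExtVanishing R C := hCI.injectiveExtVanishing.fst
  obtain ⟨Q, hQ, E, k, s, hE, hk, -⟩ := hCI.exists_step_right
  have hkC : Function.Injective (k ∘ₗ LinearMap.inl R C I) := hk.inj.comp LinearMap.inl_injective
  have hQ' := IsShortExactSeq.of_injective hkC
  set π := (LinearMap.range (k ∘ₗ LinearMap.inl R C I)).mkQ
  have hsk : ∀ y, s (k y) = 0 := fun y => (hk.exact _).2 ⟨y, rfl⟩
  obtain ⟨s', hs'⟩ := LinearMap.exists_comp_eq_of_surjective hQ'.surj s fun y hy => by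
    obtain ⟨c, rfl⟩ := (hQ'.exact _).1 hy
    exact hsk _
  have hIQ : IsShortExactSeq (π ∘ₗ k ∘ₗ LinearMap.inr R C I) s' := by
    refine ⟨(injective_iff_map_eq_zero _).2 fun e he => ?_, fun y => ?_, fun y => ?_⟩
    · obtain ⟨c, hc⟩ := (hQ'.exact _).1 he
      exact (congrArg Prod.snd (hk.inj hc)).symm
    · obtain ⟨y, rfl⟩ := hQ'.surj y
      rw [hs', hk.exact]
      constructor
      · rintro ⟨⟨c, e⟩, rfl⟩
        have : π (k (c, 0)) = 0 := (hQ'.exact _).2 ⟨c, rfl⟩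
        refine ⟨e, ?_⟩
        rw [show (c, e) = (c, 0) + (0, e) by simp, map_add, map_add, this, zero_add]
        rfl
      · rintro ⟨e, he⟩
        rw [← sub_eq_zero, LinearMap.comp_apply, ← map_sub] at he
        obtain ⟨c, hc⟩ := (hQ'.exact _).1 he
        refine ⟨(0, e) - (c, 0), ?_⟩
        rw [map_sub, sub_eq_iff_eq_add, ← sub_eq_iff_eq_add']
        exact hc.symm
    · obtain ⟨e, rfl⟩ := hk.surj y
      exact ⟨π e, hs' e⟩
  obtain ⟨B', hB', F, m, t, hF, hm, -⟩ := hB.exists_step_left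
  have hpt : Function.Surjective (p ∘ₗ t) := hs.surj.comp hm.surj
  have hK := IsShortExactSeq.of_surjective hpt
  have htm : ∀ y, t (m y) = 0 := fun y => (hm.exact _).2 ⟨y, rfl⟩
  obtain ⟨α, hα⟩ := LinearMap.exists_comp_eq_of_injective hK.inj m fun y =>
    (hK.exact _).1 (by simp [htm])
  obtain ⟨β, hβ⟩ := LinearMap.exists_comp_eq_of_injective hs.inj
    (t ∘ₗ (LinearMap.ker (p ∘ₗ t)).subtype) fun y => (hs.exact _).1 y.2
  have hKA : IsShortExactSeq α β := by
    refine ⟨fun a b hab => hm.inj (by rw [← hα, hab, hα]), fun y => ?_, fun a => ?_⟩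
    · rw [← map_eq_zero_iff _ hs.inj, hβ]
      refine (hm.exact _).trans ⟨?_, ?_⟩
      · rintro ⟨b, hb⟩
        exact ⟨b, hK.inj ((hα b).trans hb)⟩
      · rintro ⟨b, rfl⟩
        exact ⟨b, (hα b).symm⟩
    · obtain ⟨e, he⟩ := hm.surj (i a)
      exact ⟨⟨e, by simp [he, hpi]⟩, hs.inj ((hβ _).trans he)⟩
  have hKG : IsGorensteinInjective R (LinearMap.ker (p ∘ₗ t)) :=
    .of_isShortExactSeq hKA hB' hA
  exact .of_steps hKG ⟨F, _, _, hF, hK, hKG.injectiveExtVanishing _ _ _ _ hK⟩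
    (.of_isShortExactSeq hIQ (.of_injective hI) hQ) ⟨E, _, _, hE, hQ', hC _ _ _ _ hQ'⟩

end

end GorensteinInjective

section TorsionBy

variable {R : Type u} [CommRing R] (x : R)

/-- An `R`-linear map from an `R/xR`-module lands in the `x`-torsion. -/
lemma exists_lift_torsionBy {J G : Type*} [AddCommGroup J] [AddCommGroup G] [Module R J]
    [Module R G] [Module (R ⧸ Ideal.span {x}) J] [IsScalarTower R (R ⧸ Ideal.span {x}) J]
    (f : J →ₗ[R] G) :
    ∃ g : J →ₗ[R ⧸ Ideal.span {x}] Submodule.torsionBy R G x, ∀ y, (g y : G) = f y := by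
  have hx : algebraMap R (R ⧸ Ideal.span {x}) x = 0 :=
    Ideal.Quotient.eq_zero_iff_mem.2 (Ideal.mem_span_singleton_self x)
  refine ⟨LinearMap.extendScalarsOfSurjective (S := R ⧸ Ideal.span {x})
    Ideal.Quotient.mk_surjective (f.codRestrict _ fun y => ?_), fun y => rfl⟩
  rw [Submodule.mem_torsionBy_iff, ← map_smul, algebra_compatible_smul (R ⧸ Ideal.span {x}), hx,
    zero_smul, map_zero]

section

variable {x} {A B C : Type*} [AddCommGroup A] [AddCommGroup B] [AddCommGroup C]
  [Module R A] [Module R B] [Module R C] {i : A →ₗ[R] B} {p : B →ₗ[R] C}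

lemma IsShortExactSeq.torsionBy (hs : IsShortExactSeq i p) (hA : ∀ a : A, ∃ b, x • b = a)
    {i' : Submodule.torsionBy R A x →ₗ[R ⧸ Ideal.span {x}] Submodule.torsionBy R B x}
    {p' : Submodule.torsionBy R B x →ₗ[R ⧸ Ideal.span {x}] Submodule.torsionBy R C x}
    (hi' : ∀ y, (i' y : B) = i y) (hp' : ∀ y, (p' y : C) = p y) : IsShortExactSeq i' p' := by
  refine ⟨fun a b hab => Subtype.ext (hs.inj (by rw [← hi', hab, hi'])), fun y => ?_, fun y => ?_⟩
  · rw [← Subtype.val_inj, hp', Submodule.coe_zero, hs.exact]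
    constructor
    · rintro ⟨a, ha⟩
      have : x • a = 0 := hs.inj (by rw [map_smul, ha, map_zero]; exact y.2)
      exact ⟨⟨a, this⟩, Subtype.ext ((hi' _).trans ha)⟩
    · rintro ⟨a, rfl⟩
      exact ⟨a, (hi' a).symm⟩
  · obtain ⟨b, hb⟩ := hs.surj y
    obtain ⟨a, ha⟩ := (hs.exact (x • b)).1 (by rw [map_smul, hb]; exact y.2)
    obtain ⟨a, rfl⟩ := hA a
    have hpi : p (i a) = 0 := (hs.exact _).2 ⟨a, rfl⟩
    refine ⟨⟨b - i a, ?_⟩, Subtype.ext ((hp' _).trans ?_)⟩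
    · rw [Submodule.mem_torsionBy_iff, smul_sub, ← map_smul, ha, sub_self]
    · simp [hb, hpi]

/-- The connecting map of multiplication by `x` on a short exact sequence. -/
lemma IsShortExactSeq.exists_connecting (hs : IsShortExactSeq i p) (hA : IsSMulRegular A x)
    (hB : ∀ a : B, ∃ b, x • b = a) :
    ∃ (j : Submodule.torsionBy R B x →ₗ[R ⧸ Ideal.span {x}] Submodule.torsionBy R C x)
      (q : Submodule.torsionBy R C x →ₗ[R ⧸ Ideal.span {x}]
        A ⧸ (Ideal.span {x} • ⊤ : Submodule R A)), IsShortExactSeq j q := by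
  obtain ⟨j, hj⟩ := exists_lift_torsionBy x (p ∘ₗ (Submodule.torsionBy R B x).subtype)
  have hpi : ∀ a, p (i a) = 0 := fun a => (hs.exact _).2 ⟨a, rfl⟩
  have hmem : ∀ a : A, a ∈ (Ideal.span {x} • ⊤ : Submodule R A) ↔ ∃ b, x • b = a := fun a => by
    rw [Submodule.ideal_span_singleton_smul, Submodule.mem_smul_pointwise_iff_exists]
    simp
  let W : Submodule R B := (Submodule.torsionBy R C x).comap p
  have hW : ∀ w : W, p (x • w.1) = 0 := fun w => (map_smul p x w.1).trans w.2
  obtain ⟨k, hk⟩ := LinearMap.exists_comp_eq_of_injective hs.inj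
    (x • W.subtype) fun w => (hs.exact _).1 (hW w)
  have hps : Function.Surjective ((p ∘ₗ W.subtype).codRestrict (Submodule.torsionBy R C x)
      fun w => w.2) := fun c => by
    obtain ⟨b, hb⟩ := hs.surj c
    exact ⟨⟨b, show p b ∈ Submodule.torsionBy R C x from hb ▸ c.2⟩, Subtype.ext hb⟩
  obtain ⟨q, hq⟩ := LinearMap.exists_comp_eq_of_surjective hps
    ((Ideal.span {x} • ⊤ : Submodule R A).mkQ ∘ₗ k) fun w hw => by
      obtain ⟨a, ha⟩ := (hs.exact _).1 (congrArg Subtype.val hw)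
      refine (Submodule.Quotient.mk_eq_zero _).2 ((hmem _).2 ⟨a, hs.inj ?_⟩)
      rw [hk, map_smul, ha]
      rfl
  refine ⟨j, LinearMap.extendScalarsOfSurjective (S := R ⧸ Ideal.span {x})
    Ideal.Quotient.mk_surjective q, (injective_iff_map_eq_zero _).2 fun b hb => ?_,
    fun c => ?_, fun a => ?_⟩
  · have hb' : p b = 0 := by rw [show p b = _ from (hj b).symm, hb]; rfl
    obtain ⟨a, ha⟩ := (hs.exact _).1 hb'
    have : a = 0 := hA (hs.inj (by
      change i (x • a) = i (x • 0)
      rw [smul_zero, map_zero, map_smul, ha]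
      exact b.2))
    exact Subtype.ext (by rw [← ha, this, map_zero]; rfl)
  · obtain ⟨w, rfl⟩ := hps c
    refine (show _ ↔ q _ = 0 from Iff.rfl).trans ?_
    rw [hq]
    refine ((Submodule.Quotient.mk_eq_zero _).trans (hmem _)).trans ⟨?_, ?_⟩
    · rintro ⟨a, ha⟩
      have h : x • w.1 = i (x • a) := by rw [ha, hk]; rfl
      refine ⟨⟨w.1 - i a, ?_⟩, Subtype.ext ((hj _).trans ?_)⟩
      · rw [Submodule.mem_torsionBy_iff, smul_sub, h, map_smul, sub_self]
      · simp only [LinearMap.comp_apply, Submodule.subtype_apply, map_sub, hpi, sub_zero]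
        rfl
    · rintro ⟨b, hb⟩
      have h : p b = p w.1 := (hj b).symm.trans (congrArg Subtype.val hb)
      obtain ⟨a, ha⟩ := (hs.exact (w.1 - b)).1 (by rw [map_sub, h, sub_self])
      refine ⟨a, hs.inj ?_⟩
      have hb0 : x • (b : B) = 0 := b.2
      rw [hk, map_smul, ha, smul_sub, hb0, sub_zero]
      rfl
  · obtain ⟨a, rfl⟩ := Submodule.mkQ_surjective _ a
    obtain ⟨b, hb⟩ := hB (i a)
    have hbW : b ∈ W := by
      change x • p b = 0
      rw [← map_smul, hb, hpi]
    refine ⟨_, (hq ⟨b, hbW⟩).trans ?_⟩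
    rw [LinearMap.comp_apply]
    congr 1
    exact hs.inj ((hk _).trans hb)

end

variable {x}

lemma Module.Injective.exists_smul_eq {I : Type u} [AddCommGroup I] [Module R I]
    (hI : Module.Injective R I) (hx : x ∈ nonZeroDivisors R) (y : I) : ∃ z, x • z = y := by
  obtain ⟨h, hh⟩ := hI.out (LinearMap.mulLeft R x)
    (fun a b hab => (mul_cancel_left_mem_nonZeroDivisors hx).1 hab)
    (LinearMap.toSpanSingleton R I y)
  exact ⟨h 1, by rw [← map_smul]; simpa using hh 1⟩

lemma IsGorensteinInjective.exists_smul_eq {G : Type u} [AddCommGroup G] [Module R G]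
    (hG : IsGorensteinInjective R G) (hx : x ∈ nonZeroDivisors R) (y : G) : ∃ z, x • z = y := by
  obtain ⟨K, -, I, i, p, hI, hs, -⟩ := hG.exists_step_left
  obtain ⟨w, rfl⟩ := hs.surj y
  obtain ⟨z, rfl⟩ := hI.exists_smul_eq hx w
  exact ⟨p z, (map_smul p x z).symm⟩

lemma Module.Injective.torsionBy {I : Type u} [AddCommGroup I] [Module R I]
    (hI : Module.Injective R I) :
    Module.Injective (R ⧸ Ideal.span {x}) (Submodule.torsionBy R I x) := by
  refine ⟨fun X Y _ _ _ _ i hi f => ?_⟩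
  let _ := Module.compHom X (algebraMap R (R ⧸ Ideal.span {x}))
  let _ := Module.compHom Y (algebraMap R (R ⧸ Ideal.span {x}))
  have : IsScalarTower R (R ⧸ Ideal.span {x}) X := .of_algebraMap_smul fun _ _ => rfl
  have : IsScalarTower R (R ⧸ Ideal.span {x}) Y := .of_algebraMap_smul fun _ _ => rfl
  obtain ⟨g, hg⟩ := hI.out (i.restrictScalars R) hi
    ((Submodule.torsionBy R I x).subtype ∘ₗ f.restrictScalars R)
  obtain ⟨h, hh⟩ := exists_lift_torsionBy x g
  exact ⟨h, fun y => Subtype.ext ((hh _).trans (hg y))⟩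

lemma exists_injective_embedding (J : Type u) [AddCommGroup J] [Module R J] :
    ∃ (E : ModuleCat.{u} R) (i : J →ₗ[R] E), Module.Injective R E ∧ Function.Injective i := by
  let X := ModuleCat.of R J
  exact ⟨Injective.under X, (Injective.ι X).hom,
    Module.injective_module_of_injective_object (inj := Injective.injective_under X),
    (ModuleCat.mono_iff_injective (Injective.ι X)).1 inferInstance⟩

/-- If `p` lifts injectives and maps onto a Gorenstein injective module, then the map it induces on
`x`-torsion lifts injective `R/xR`-modules. -/
lemma LiftsInjectives.torsionBy {B G : Type u} [AddCommGroup B] [AddCommGroup G] [Module R B]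
    [Module R G] (hx : x ∈ nonZeroDivisors R) (hG : IsGorensteinInjective R G) {p : B →ₗ[R] G}
    (hp : LiftsInjectives p)
    {p' : Submodule.torsionBy R B x →ₗ[R ⧸ Ideal.span {x}] Submodule.torsionBy R G x}
    (hp' : ∀ y, (p' y : G) = p y) : LiftsInjectives p' := by
  intro J _ _ hJ f
  let _ := Module.compHom J (algebraMap R (R ⧸ Ideal.span {x}))
  have : IsScalarTower R (R ⧸ Ideal.span {x}) J := .of_algebraMap_smul fun _ _ => rfl
  obtain ⟨E, i, hE, hi⟩ := exists_injective_embedding (R := R) J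
  obtain ⟨i', hi'⟩ := exists_lift_torsionBy x i
  have inj : Function.Injective i' := fun a b hab => hi (by rw [← hi', hab, hi'])
  obtain ⟨r, hr⟩ := hJ.out i' inj .id
  have hs : IsShortExactSeq (Submodule.torsionBy R E x).subtype (x • .id : E →ₗ[R] E) :=
    ⟨Subtype.val_injective, fun y => ⟨fun h => ⟨⟨y, h⟩, rfl⟩, by rintro ⟨y, rfl⟩; exact y.2⟩,
      fun y => hE.exists_smul_eq hx y⟩
  obtain ⟨F, hF⟩ := hG.exists_extension hs hE
    ((Submodule.torsionBy R G x).subtype ∘ₗ (f ∘ₗ r).restrictScalars R)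
  obtain ⟨F', hF'⟩ := hp E hE F
  obtain ⟨g, hg⟩ := exists_lift_torsionBy x (F' ∘ₗ (Submodule.torsionBy R E x).subtype)
  refine ⟨g ∘ₗ i', fun y => Subtype.ext ?_⟩
  rw [hp', LinearMap.comp_apply, hg, LinearMap.comp_apply, hF', hF]
  simp [hr]

/-- The `x`-torsion of a Gorenstein injective `R`-module is Gorenstein injective over `R/xR`. -/
lemma IsGorensteinInjective.torsionBy {G : Type u} [AddCommGroup G] [Module R G]
    (hG : IsGorensteinInjective R G) (hx : x ∈ nonZeroDivisors R) :
    IsGorensteinInjective (R ⧸ Ideal.span {x}) (Submodule.torsionBy R G x) := by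
  have step : ∀ {K G : Type u} [AddCommGroup K] [AddCommGroup G] [Module R K] [Module R G],
      IsGorensteinInjective R K → IsGorensteinInjective R G → InjectiveStep R K G →
      InjectiveStep (R ⧸ Ideal.span {x}) (Submodule.torsionBy R K x)
        (Submodule.torsionBy R G x) := by
    rintro K G _ _ _ _ hK hG ⟨I, i, p, hI, hs, hp⟩
    obtain ⟨i', hi'⟩ := exists_lift_torsionBy x (i ∘ₗ (Submodule.torsionBy R K x).subtype)
    obtain ⟨p', hp'⟩ := exists_lift_torsionBy x (p ∘ₗ (Submodule.torsionBy R I x).subtype)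
    exact ⟨ModuleCat.of _ (Submodule.torsionBy R I x), i', p', hI.torsionBy,
      hs.torsionBy (hK.exists_smul_eq hx) hi' hp', hp.torsionBy hx hG hp'⟩
  refine IsStepStable.isGorensteinInjective (𝒢 := fun X => ∃ G : ModuleCat.{u} R,
    IsGorensteinInjective R G ∧
      Nonempty (X ≃ₗ[R ⧸ Ideal.span {x}] Submodule.torsionBy R G x)) ?_
    (G := ModuleCat.of _ (Submodule.torsionBy R G x)) ⟨ModuleCat.of R G, hG, ⟨.refl _ _⟩⟩
  rintro X ⟨G, hG, ⟨e⟩⟩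
  obtain ⟨K, hK, hKG⟩ := hG.exists_step_left
  obtain ⟨Q, hQ, hGQ⟩ := hG.exists_step_right
  exact ⟨⟨ModuleCat.of _ (Submodule.torsionBy R K x), ⟨K, hK, ⟨.refl _ _⟩⟩,
      (step hK hG hKG).congr (.refl _ _) e.symm⟩,
    ⟨ModuleCat.of _ (Submodule.torsionBy R Q x), ⟨Q, hQ, ⟨.refl _ _⟩⟩,
      (step hG hQ hGQ).congr e (.refl _ _)⟩⟩

end TorsionBy

section HasGidLE

variable {R : Type u} [CommRing R]

lemma hasGidLE_zero_iff {M : Type u} [AddCommGroup M] [Module R M] :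
    HasGidLE R M 0 ↔ IsGorensteinInjective R M := by
  constructor
  · rintro ⟨G, e, d, hG, he, hed, -, h0⟩
    have := h0 1 one_pos
    refine (hG 0).congr (LinearEquiv.ofBijective e ⟨he, fun y => (hed y).1 ?_⟩)
    exact Subsingleton.elim _ _
  · intro h
    refine ⟨fun | 0 => ModuleCat.of R M | _ + 1 => ModuleCat.of R PUnit, .id, fun _ => 0,
      ?_, Function.injective_id, fun y => by simp, fun i y => ?_, ?_⟩
    · rintro (_ | i)
      · exact h
      · exact .of_injective (G := PUnit) Module.injective_of_subsingleton
    · exact ⟨fun _ => ⟨0, Subsingleton.elim (α := PUnit) _ _⟩, fun _ => rfl⟩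
    · rintro (_ | i) hi
      · exact absurd hi (lt_irrefl 0)
      · exact inferInstanceAs (Subsingleton PUnit)

lemma hasGidLE_succ_iff {M : Type u} [AddCommGroup M] [Module R M] {n : ℕ} :
    HasGidLE R M (n + 1) ↔ ∃ (G N : ModuleCat.{u} R) (i : M →ₗ[R] G) (p : G →ₗ[R] N),
      IsShortExactSeq i p ∧ IsGorensteinInjective R G ∧ HasGidLE R N n := by
  constructor
  · rintro ⟨G, e, d, hG, he, hed, hd, h0⟩
    refine ⟨G 0, ModuleCat.of R (LinearMap.ker (d 1)), e,
      (d 0).codRestrict _ fun y => (hd 0 _).2 ⟨y, rfl⟩, ⟨he, fun y => ?_, ?_⟩, hG 0,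
      fun i => G (i + 1), (LinearMap.ker (d 1)).subtype, fun i => d (i + 1),
      fun i => hG _, Subtype.val_injective, fun y => ?_, fun i => hd _,
      fun i hi => h0 _ (Nat.succ_lt_succ hi)⟩
    · rw [← hed y, ← Subtype.val_inj]
      rfl
    · rintro ⟨y, hy⟩
      obtain ⟨z, rfl⟩ := (hd 0 y).1 hy
      exact ⟨z, rfl⟩
    · exact ⟨fun h => ⟨⟨y, h⟩, rfl⟩, by rintro ⟨y, rfl⟩; exact y.2⟩
  · rintro ⟨G, N, i, p, hs, hG, G', e, d, hG', he, hed, hd, h0⟩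
    refine ⟨fun | 0 => G | i + 1 => G' i, i, fun | 0 => e ∘ₗ p | i + 1 => d i, ?_, hs.inj,
      fun y => ?_, ?_, ?_⟩
    · rintro (_ | i)
      exacts [hG, hG' i]
    · exact (map_eq_zero_iff e he).trans (hs.exact y)
    · rintro (_ | i)
      · intro y
        refine (hed y).trans ⟨?_, ?_⟩
        · rintro ⟨z, rfl⟩
          obtain ⟨w, rfl⟩ := hs.surj z
          exact ⟨w, rfl⟩
        · rintro ⟨w, rfl⟩
          exact ⟨p w, rfl⟩
      · exact hd i
    · rintro (_ | i) hi
      · exact absurd hi (Nat.not_lt_zero _)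
      · exact h0 i (Nat.lt_of_succ_lt_succ hi)

/-- Dividing out a Gorenstein injective submodule does not increase the dimension. -/
lemma HasGidLE.of_isShortExactSeq {A B C : Type u} [AddCommGroup A] [AddCommGroup B]
    [AddCommGroup C] [Module R A] [Module R B] [Module R C] {i : A →ₗ[R] B} {p : B →ₗ[R] C}
    (hs : IsShortExactSeq i p) (hA : IsGorensteinInjective R A) {n : ℕ} (hB : HasGidLE R B n) :
    HasGidLE R C n := by
  cases n with
  | zero =>
    rw [hasGidLE_zero_iff] at *
    exact hA.of_isShortExactSeq_right hs hB
  | succ n =>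
    obtain ⟨G, N, j, q, hj, hG, hN⟩ := hasGidLE_succ_iff.1 hB
    have hQ := IsShortExactSeq.of_injective (i := j ∘ₗ i) (hj.inj.comp hs.inj)
    set π := (LinearMap.range (j ∘ₗ i)).mkQ
    obtain ⟨α, hα⟩ := LinearMap.exists_comp_eq_of_surjective hs.surj (π ∘ₗ j) fun b hb => by
      obtain ⟨a, rfl⟩ := (hs.exact _).1 hb
      exact (hQ.exact _).2 ⟨a, rfl⟩
    obtain ⟨β, hβ⟩ := LinearMap.exists_comp_eq_of_surjective hQ.surj q fun y hy => by
      obtain ⟨a, rfl⟩ := (hQ.exact _).1 hy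
      exact (hj.exact _).2 ⟨i a, rfl⟩
    refine hasGidLE_succ_iff.2 ⟨ModuleCat.of R (G ⧸ LinearMap.range (j ∘ₗ i)), N, α, β,
      ⟨(injective_iff_map_eq_zero _).2 fun c hc => ?_, fun y => ?_, fun y => ?_⟩,
      hA.of_isShortExactSeq_right hQ hG, hN⟩
    · obtain ⟨b, rfl⟩ := hs.surj c
      rw [hα] at hc
      obtain ⟨a, ha⟩ := (hQ.exact _).1 hc
      exact (hs.exact _).2 ⟨a, hj.inj ha⟩
    · obtain ⟨y, rfl⟩ := hQ.surj y
      rw [hβ, hj.exact]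
      constructor
      · rintro ⟨b, rfl⟩
        exact ⟨p b, hα b⟩
      · rintro ⟨c, hc⟩
        obtain ⟨b, rfl⟩ := hs.surj c
        rw [hα] at hc
        refine (hj.exact _).1 ?_
        rw [← hβ, ← hc]
        exact (hβ _).trans ((hj.exact _).2 ⟨b, rfl⟩)
    · obtain ⟨y, rfl⟩ := hj.surj y
      exact ⟨π y, hβ y⟩

variable {x : R}

lemma HasGidLE.torsionBy (hx : x ∈ nonZeroDivisors R) {n : ℕ} {N : Type u} [AddCommGroup N]
    [Module R N] (hN : HasGidLE R N n) (hdiv : ∀ y : N, ∃ z, x • z = y) :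
    HasGidLE (R ⧸ Ideal.span {x}) (Submodule.torsionBy R N x) n := by
  induction n generalizing N with
  | zero =>
    rw [hasGidLE_zero_iff] at *
    exact hN.torsionBy hx
  | succ n ih =>
    obtain ⟨G, N', i, p, hs, hG, hN'⟩ := hasGidLE_succ_iff.1 hN
    obtain ⟨i', hi'⟩ := exists_lift_torsionBy x (i ∘ₗ (Submodule.torsionBy R N x).subtype)
    obtain ⟨p', hp'⟩ := exists_lift_torsionBy x (p ∘ₗ (Submodule.torsionBy R G x).subtype)
    refine hasGidLE_succ_iff.2 ⟨ModuleCat.of _ (Submodule.torsionBy R G x),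
      ModuleCat.of _ (Submodule.torsionBy R N' x), i', p', hs.torsionBy hdiv hi' hp',
      hG.torsionBy hx, ih hN' fun y => ?_⟩
    obtain ⟨w, rfl⟩ := hs.surj y
    obtain ⟨z, rfl⟩ := hG.exists_smul_eq hx w
    exact ⟨p z, (map_smul p x z).symm⟩

/-- Reduction modulo a regular element lowers the Gorenstein injective dimension. -/
lemma HasGidLE.quotient (hx : x ∈ nonZeroDivisors R) {n : ℕ} {M : Type u} [AddCommGroup M]
    [Module R M] (hM : HasGidLE R M (n + 1)) (hxM : IsSMulRegular M x) :
    HasGidLE (R ⧸ Ideal.span {x}) (M ⧸ (Ideal.span {x} • ⊤ : Submodule R M)) n := by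
  obtain ⟨G, N, i, p, hs, hG, hN⟩ := hasGidLE_succ_iff.1 hM
  obtain ⟨j, q, hjq⟩ := hs.exists_connecting hxM (hG.exists_smul_eq hx)
  refine .of_isShortExactSeq hjq (hG.torsionBy hx) (hN.torsionBy hx fun y => ?_)
  obtain ⟨w, rfl⟩ := hs.surj y
  obtain ⟨z, rfl⟩ := hG.exists_smul_eq hx w
  exact ⟨p z, (map_smul p x z).symm⟩

lemma HasGidLE.gid_le {M : Type u} [AddCommGroup M] [Module R M] {n : ℕ} (h : HasGidLE R M n) :
    Gid R M ≤ n :=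
  sInf_le ⟨n, rfl, h⟩

lemma exists_hasGidLE_of_gid_ne_top {M : Type u} [AddCommGroup M] [Module R M]
    (h : Gid R M ≠ ⊤) : ∃ n : ℕ, Gid R M = n ∧ HasGidLE R M n := by
  refine csInf_mem (s := {c : ℕ∞ | ∃ n : ℕ, c = n ∧ HasGidLE R M n}) ?_
  by_contra! hempty
  exact h (by rw [Gid, hempty, sInf_empty])

end HasGidLE

/-- Nakayama's lemma for a module that is finite over a local homomorphism. -/
lemma subsingleton_of_forall_exists_smul_eq {R S : Type*} [CommRing R] [CommRing S]
    [IsLocalRing R] [IsLocalRing S] [Algebra R S] [IsLocalHom (algebraMap R S)] {M : Type*}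
    [AddCommGroup M] [Module S M] [Module R M] [IsScalarTower R S M] [Module.Finite S M]
    {x : R} (hx : x ∈ maximalIdeal R) (h : ∀ y : M, ∃ z, x • z = y) : Subsingleton M := by
  rw [← Submodule.subsingleton_iff S, ← subsingleton_iff_bot_eq_top, eq_comm]
  refine Submodule.eq_bot_of_le_smul_of_le_jacobson_bot (maximalIdeal S) ⊤ Module.Finite.fg_top
    (fun y _ => ?_) (maximalIdeal_le_jacobson _)
  obtain ⟨z, rfl⟩ := h y
  rw [← algebraMap_smul S x z]
  refine Submodule.smul_mem_smul ?_ trivial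
  rwa [mem_maximalIdeal, map_mem_nonunits_iff]

theorem gid_quotient_le (R S : Type u) [CommRing R] [CommRing S] [IsNoetherianRing R] [IsNoetherianRing S]
    [IsLocalRing R] [IsLocalRing S] [Algebra R S] [IsLocalHom (algebraMap R S)]
    (M : Type u) [AddCommGroup M] [Module S M] [Module R M] [IsScalarTower R S M] [Module.Finite S M]
    (x : R) (hx : x ∈ IsLocalRing.maximalIdeal R)
    (hxR : x ∈ nonZeroDivisors R) (hxM : IsSMulRegular M x)
    (hfin : Gid R M ≠ ⊤) :
    Gid (R ⧸ Ideal.span {x}) (M ⧸ (Ideal.span {x} • ⊤ : Submodule R M)) ≤ Gid R M - 1 := by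
  obtain ⟨n, hn, h⟩ := exists_hasGidLE_of_gid_ne_top hfin
  rw [hn]
  cases n with
  | zero =>
    have : Subsingleton M := subsingleton_of_forall_exists_smul_eq (S := S) hx
      ((hasGidLE_zero_iff.1 h).exists_smul_eq hxR)
    exact (HasGidLE.gid_le (hasGidLE_zero_iff.2
      (.of_injective Module.injective_of_subsingleton))).trans (by simp)
  | succ n =>
    exact (h.quotient hxR hxM).gid_le.trans (by exact_mod_cast (Nat.add_sub_cancel n 1).ge)

end
end
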